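/- Let (g,c,n) be a v-admissible triplet with g ≥ 5. Then g/4 ≤ A(g,c,n), and: (i) if c < 3g-4, then A(g,c,n) ≤ (2g-1)/4; (ii) if c = 3g-4, then A(g,c,n) ≤ (g+2)/4 when g is even and A(g,c,n) ≤ (g+3)/4 when g is odd; (iii) if c > 3g-4, then A(g,c,n) ≤ (3g+5)/8 when g is even and A(g,c,n) ≤ (3g+7)/8 when g is odd. -/

import Mathlib

open SimpleGraph Set

/-- Auxiliary distance on representations of points of the metric graph:
a point is represented by `(u, v, t)` with `u, v` adjacent and `t ∈ [0,1]`,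
meaning the point on the edge `[u,v]` at distance `t` from `u`. -/
noncomputable def mgDistAux {V : Type} [Fintype V] [DecidableEq V] (G : SimpleGraph V)
    (p q : V × V × ℝ) : ℝ :=
  min
    (min (if p.1 = q.1 ∧ p.2.1 = q.2.1 then |p.2.2 - q.2.2| else (Fintype.card V : ℝ) + 1)
         (if p.1 = q.2.1 ∧ p.2.1 = q.1 then |p.2.2 - (1 - q.2.2)| else (Fintype.card V : ℝ) + 1))
    (min (min (p.2.2 + (G.dist p.1 q.1 : ℝ) + q.2.2)
              (p.2.2 + (G.dist p.1 q.2.1 : ℝ) + (1 - q.2.2)))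
         (min ((1 - p.2.2) + (G.dist p.2.1 q.1 : ℝ) + q.2.2)
              ((1 - p.2.2) + (G.dist p.2.1 q.2.1 : ℝ) + (1 - q.2.2))))

/-- The points of the metric graph associated to a simple graph `G`:
the vertices together with the interior points of the edges. -/
def MGPoint {V : Type} (G : SimpleGraph V) : Type :=
  {p : V × V × ℝ // G.Adj p.1 p.2.1 ∧ p.2.2 ∈ Set.Icc (0 : ℝ) 1}

/-- The shortest-path distance on the metric graph associated to `G`
(every edge has length 1). -/
noncomputable def mgDist {V : Type} [Fintype V] [DecidableEq V] (G : SimpleGraph V)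
    (p q : MGPoint G) : ℝ := mgDistAux G p.1 q.1

/-- Distance from a vertex `v` to a point of the metric graph. -/
noncomputable def mgVDist {V : Type} [Fintype V] [DecidableEq V] (G : SimpleGraph V)
    (v : V) (x : MGPoint G) : ℝ :=
  min ((G.dist v x.1.1 : ℝ) + x.1.2.2) ((G.dist v x.1.2.1 : ℝ) + (1 - x.1.2.2))

/-- `γ` restricted to `[a,b]` is a geodesic in the metric graph of `G`
(an arc-length parametrization realizing distances). -/
def IsMGGeodesic {V : Type} [Fintype V] [DecidableEq V] (G : SimpleGraph V)
    (a b : ℝ) (γ : ℝ → MGPoint G) : Prop :=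
  a ≤ b ∧ ∀ s ∈ Set.Icc a b, ∀ t ∈ Set.Icc a b, mgDist G (γ s) (γ t) = |s - t|

/-- A geodesic triangle in the metric graph of `G`: three geodesic sides whose
endpoints match cyclically (distance `0` means equality of points). -/
structure MGTriangle {V : Type} [Fintype V] [DecidableEq V] (G : SimpleGraph V) where
  a1 : ℝ
  b1 : ℝ
  a2 : ℝ
  b2 : ℝ
  a3 : ℝ
  b3 : ℝ
  g1 : ℝ → MGPoint G
  g2 : ℝ → MGPoint G
  g3 : ℝ → MGPoint G
  h1 : IsMGGeodesic G a1 b1 g1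
  h2 : IsMGGeodesic G a2 b2 g2
  h3 : IsMGGeodesic G a3 b3 g3
  glue1 : mgDist G (g1 b1) (g2 a2) = 0
  glue2 : mgDist G (g2 b2) (g3 a3) = 0
  glue3 : mgDist G (g3 b3) (g1 a1) = 0

/-- The sharp thin constant `δ(T)` of a geodesic triangle: the infimum of the
`d ≥ 0` such that each side is contained in the `d`-neighborhood of the union of
the other two sides. -/
noncomputable def triangleDelta {V : Type} [Fintype V] [DecidableEq V] {G : SimpleGraph V}
    (T : MGTriangle G) : ℝ :=
  sInf {d : ℝ | 0 ≤ d ∧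
    (∀ s ∈ Set.Icc T.a1 T.b1,
      (∃ t ∈ Set.Icc T.a2 T.b2, mgDist G (T.g1 s) (T.g2 t) ≤ d) ∨
      (∃ t ∈ Set.Icc T.a3 T.b3, mgDist G (T.g1 s) (T.g3 t) ≤ d)) ∧
    (∀ s ∈ Set.Icc T.a2 T.b2,
      (∃ t ∈ Set.Icc T.a1 T.b1, mgDist G (T.g2 s) (T.g1 t) ≤ d) ∨
      (∃ t ∈ Set.Icc T.a3 T.b3, mgDist G (T.g2 s) (T.g3 t) ≤ d)) ∧
    (∀ s ∈ Set.Icc T.a3 T.b3,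
      (∃ t ∈ Set.Icc T.a1 T.b1, mgDist G (T.g3 s) (T.g1 t) ≤ d) ∨
      (∃ t ∈ Set.Icc T.a2 T.b2, mgDist G (T.g3 s) (T.g2 t) ≤ d))}

/-- The hyperbolicity constant `δ(G)`: the supremum of `δ(T)` over all geodesic
triangles `T` in the metric graph of `G`. -/
noncomputable def hypDelta {V : Type} [Fintype V] [DecidableEq V] (G : SimpleGraph V) : ℝ :=
  sSup {d : ℝ | ∃ T : MGTriangle G, d = triangleDelta T}

/-- The circumference of `G`: the length of a longest cycle. -/
noncomputable def circumference {V : Type} (G : SimpleGraph V) : ℕ :=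
  sSup {n : ℕ | ∃ (a : V) (w : G.Walk a a), w.IsCycle ∧ w.length = n}

/-- `G` belongs to the class `𝒢(g,c,n)` of (connected) graphs with girth `g`,
circumference `c` and `n` vertices (vertex set `Fin n`). -/
def memGclass (g c : ℕ) {n : ℕ} (G : SimpleGraph (Fin n)) : Prop :=
  G.Connected ∧ G.girth = g ∧ circumference G = c

/-- `A(g,c,n) = min {δ(G) : G ∈ 𝒢(g,c,n)}`. -/
noncomputable def Agcn (g c n : ℕ) : ℝ :=
  sInf {d : ℝ | ∃ G : SimpleGraph (Fin n), memGclass g c G ∧ d = hypDelta G}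

/-- `B(g,c,n) = max {δ(G) : G ∈ 𝒢(g,c,n)}`. -/
noncomputable def Bgcn (g c n : ℕ) : ℝ :=
  sSup {d : ℝ | ∃ G : SimpleGraph (Fin n), memGclass g c G ∧ d = hypDelta G}

/-- `G` belongs to the class `ℋ(g,c,m)` of (connected) graphs with girth `g`,
circumference `c` and `m` edges. -/
def memHclass (g c m : ℕ) {k : ℕ} (G : SimpleGraph (Fin k)) : Prop :=
  G.Connected ∧ G.girth = g ∧ circumference G = c ∧ G.edgeSet.ncard = m

/-- `α(g,c,m) = min {δ(G) : G ∈ ℋ(g,c,m)}`. -/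
noncomputable def alphagcm (g c m : ℕ) : ℝ :=
  sInf {d : ℝ | ∃ (k : ℕ) (G : SimpleGraph (Fin k)), memHclass g c m G ∧ d = hypDelta G}

/-- `β(g,c,m) = max {δ(G) : G ∈ ℋ(g,c,m)}`. -/
noncomputable def betagcm (g c m : ℕ) : ℝ :=
  sSup {d : ℝ | ∃ (k : ℕ) (G : SimpleGraph (Fin k)), memHclass g c m G ∧ d = hypDelta G}


open SimpleGraph Set
set_option linter.unusedSectionVars false
set_option linter.unusedVariables false
section Metric
variable {V : Type} [Fintype V] [DecidableEq V] {G : SimpleGraph V}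

lemma dist_lt_card' (hG : G.Connected) (u v : V) : G.dist u v < Fintype.card V := by
  obtain ⟨p, hp, hl⟩ := hG.exists_path_of_dist u v
  rw [← hl]; exact hp.length_lt

lemma mgDist_le_card (p q : MGPoint G) : mgDist G p q ≤ (Fintype.card V : ℝ) + 1 := by
  unfold mgDist mgDistAux
  refine (min_le_left _ _).trans ((min_le_left _ _).trans ?_)
  obtain ⟨⟨u, u', t⟩, h, ht⟩ := p
  obtain ⟨⟨v, v', s⟩, h', hs⟩ := q
  simp only [Set.mem_Icc] at ht hs ⊢
  have : (0:ℝ) ≤ Fintype.card V := by positivity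
  split_ifs
  · rw [abs_le]; constructor <;> linarith [ht.1, ht.2, hs.1, hs.2]
  · exact le_rfl

lemma vd_nonneg (v : V) (p : MGPoint G) : 0 ≤ mgVDist G v p := by
  obtain ⟨⟨u, u', t⟩, h, ht⟩ := p
  simp only [Set.mem_Icc] at ht
  unfold mgVDist
  refine le_min ?_ ?_ <;> simp only <;> have := ht.1 <;> have := ht.2
  · positivity
  · have : (0:ℝ) ≤ G.dist v u' := by positivity
    linarith

lemma dist_triR (hG : G.Connected) (u v w : V) :
    (G.dist u w : ℝ) ≤ G.dist u v + G.dist v w := by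
  exact_mod_cast hG.dist_triangle

lemma vd_tri (hG : G.Connected) (v u : V) (p : MGPoint G) :
    mgVDist G v p ≤ G.dist v u + mgVDist G u p := by
  obtain ⟨⟨a, b, t⟩, h, ht⟩ := p
  have h1 := dist_triR hG v u a
  have h2 := dist_triR hG v u b
  unfold mgVDist
  simp only
  rcases min_cases ((G.dist u a : ℝ) + t) ((G.dist u b : ℝ) + (1 - t)) with ⟨e, _⟩ | ⟨e, _⟩ <;> rw [e]
  · exact (min_le_left _ _).trans (by linarith)
  · exact (min_le_right _ _).trans (by linarith)

/-- upper bound of the distance through a vertex -/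
lemma mgDist_le_vd (hG : G.Connected) (v : V) (p q : MGPoint G) :
    mgDist G p q ≤ mgVDist G v p + mgVDist G v q := by
  obtain ⟨⟨a, b, t⟩, h, ht⟩ := p
  obtain ⟨⟨a', b', t'⟩, h', ht'⟩ := q
  have c1 : (G.dist v a : ℝ) = G.dist a v := by rw [SimpleGraph.dist_comm]
  have c2 : (G.dist v b : ℝ) = G.dist b v := by rw [SimpleGraph.dist_comm]
  have h1 := dist_triR hG a v a'
  have h2 := dist_triR hG a v b'
  have h3 := dist_triR hG b v a'
  have h4 := dist_triR hG b v b'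
  unfold mgVDist mgDist mgDistAux
  simp only
  refine (min_le_right _ _).trans ?_
  rcases min_cases ((G.dist v a : ℝ) + t) ((G.dist v b : ℝ) + (1 - t)) with ⟨e, _⟩ | ⟨e, _⟩ <;>
  rcases min_cases ((G.dist v a' : ℝ) + t') ((G.dist v b' : ℝ) + (1 - t')) with ⟨e', _⟩ | ⟨e', _⟩ <;>
  rw [e, e']
  · exact (min_le_left _ _).trans ((min_le_left _ _).trans (by linarith))
  · exact (min_le_left _ _).trans ((min_le_right _ _).trans (by linarith))
  · exact (min_le_right _ _).trans ((min_le_left _ _).trans (by linarith))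
  · exact (min_le_right _ _).trans ((min_le_right _ _).trans (by linarith))

/-- the two endpoints -/
def isEnd (a : V) (p : MGPoint G) : Prop := a = p.1.1 ∨ a = p.1.2.1

lemma mgDist_cases (hG : G.Connected) (p q : MGPoint G) :
    (∃ a b, isEnd a p ∧ isEnd b q ∧
      mgDist G p q = mgVDist G a p + G.dist a b + mgVDist G b q) ∨
    (p.1.1 = q.1.1 ∧ p.1.2.1 = q.1.2.1 ∧ mgDist G p q = |p.1.2.2 - q.1.2.2|) ∨
    (p.1.1 = q.1.2.1 ∧ p.1.2.1 = q.1.1 ∧ mgDist G p q = |p.1.2.2 - (1 - q.1.2.2)|) := by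
  by_cases hc1 : p.1.1 = q.1.1 ∧ p.1.2.1 = q.1.2.1 ∧ mgDist G p q = |p.1.2.2 - q.1.2.2|
  · exact Or.inr (Or.inl hc1)
  by_cases hc2 : p.1.1 = q.1.2.1 ∧ p.1.2.1 = q.1.1 ∧ mgDist G p q = |p.1.2.2 - (1 - q.1.2.2)|
  · exact Or.inr (Or.inr hc2)
  left
  have key : ∀ a b, isEnd a p → isEnd b q →
      mgDist G p q ≤ mgVDist G a p + G.dist a b + mgVDist G b q := by
    intro a b _ _
    have := mgDist_le_vd hG a p q
    have := vd_tri hG a b q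
    linarith
  obtain ⟨⟨a, b, t⟩, h, ht⟩ := p
  obtain ⟨⟨a', b', t'⟩, h', ht'⟩ := q
  have va : mgVDist G a ⟨⟨a, b, t⟩, h, ht⟩ ≤ t := by
    unfold mgVDist; refine (min_le_left _ _).trans ?_; simp
  have vb : mgVDist G b ⟨⟨a, b, t⟩, h, ht⟩ ≤ 1 - t := by
    unfold mgVDist; refine (min_le_right _ _).trans ?_; simp
  have va' : mgVDist G a' ⟨⟨a', b', t'⟩, h', ht'⟩ ≤ t' := by
    unfold mgVDist; refine (min_le_left _ _).trans ?_; simp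
  have vb' : mgVDist G b' ⟨⟨a', b', t'⟩, h', ht'⟩ ≤ 1 - t' := by
    unfold mgVDist; refine (min_le_right _ _).trans ?_; simp
  set P : MGPoint G := ⟨⟨a, b, t⟩, h, ht⟩ with hP
  set Q : MGPoint G := ⟨⟨a', b', t'⟩, h', ht'⟩ with hQ
  have k1 := key a a' (Or.inl rfl) (Or.inl rfl)
  have k2 := key a b' (Or.inl rfl) (Or.inr rfl)
  have k3 := key b a' (Or.inr rfl) (Or.inl rfl)
  have k4 := key b b' (Or.inr rfl) (Or.inr rfl)
  simp only [Set.mem_Icc] at ht ht'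
  have hcard : (G.dist a a' : ℝ) + 1 ≤ Fintype.card V := by
    exact_mod_cast dist_lt_card' hG a a'
  have hcases : mgDist G P Q = (if a = a' ∧ b = b' then |t - t'| else (Fintype.card V : ℝ) + 1) ∨
      mgDist G P Q = (if a = b' ∧ b = a' then |t - (1 - t')| else (Fintype.card V : ℝ) + 1) ∨
      mgDist G P Q = t + G.dist a a' + t' ∨ mgDist G P Q = t + G.dist a b' + (1 - t') ∨
      mgDist G P Q = (1 - t) + G.dist b a' + t' ∨ mgDist G P Q = (1 - t) + G.dist b b' + (1 - t') := by
    have : mgDist G P Q = min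
      (min (if a = a' ∧ b = b' then |t - t'| else (Fintype.card V : ℝ) + 1)
         (if a = b' ∧ b = a' then |t - (1 - t')| else (Fintype.card V : ℝ) + 1))
       (min (min (t + (G.dist a a' : ℝ) + t')
              (t + (G.dist a b' : ℝ) + (1 - t')))
         (min ((1 - t) + (G.dist b a' : ℝ) + t')
              ((1 - t) + (G.dist b b' : ℝ) + (1 - t')))) := rfl
    rw [this]
    generalize (if a = a' ∧ b = b' then |t - t'| else (Fintype.card V : ℝ) + 1) = x1
    generalize (if a = b' ∧ b = a' then |t - (1 - t')| else (Fintype.card V : ℝ) + 1) = x2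
    rcases min_choice (min x1 x2) (min (min (t + (G.dist a a' : ℝ) + t')
              (t + (G.dist a b' : ℝ) + (1 - t')))
         (min ((1 - t) + (G.dist b a' : ℝ) + t')
              ((1 - t) + (G.dist b b' : ℝ) + (1 - t')))) with e | e <;> rw [e]
    · rcases min_choice x1 x2 with e | e <;> rw [e] <;> simp
    · rcases min_choice (min (t + (G.dist a a' : ℝ) + t')
              (t + (G.dist a b' : ℝ) + (1 - t')))
         (min ((1 - t) + (G.dist b a' : ℝ) + t')
              ((1 - t) + (G.dist b b' : ℝ) + (1 - t'))) with e | e <;> rw [e]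
      · rcases min_choice (t + (G.dist a a' : ℝ) + t')
              (t + (G.dist a b' : ℝ) + (1 - t')) with e | e <;> rw [e] <;> simp
      · rcases min_choice ((1 - t) + (G.dist b a' : ℝ) + t')
              ((1 - t) + (G.dist b b' : ℝ) + (1 - t')) with e | e <;> rw [e] <;> simp
  have e1 : isEnd a P := Or.inl rfl
  have e2 : isEnd b P := Or.inr rfl
  have e3 : isEnd a' Q := Or.inl rfl
  have e4 : isEnd b' Q := Or.inr rfl
  have dflt : mgDist G P Q = (Fintype.card V : ℝ) + 1 → mgDist G P Q = mgVDist G a P + G.dist a a' + mgVDist G a' Q := by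
    intro e; linarith
  rcases hcases with e | e | e | e | e | e
  · split_ifs at e with hh
    · exact absurd ⟨hh.1, hh.2, e⟩ hc1
    · exact ⟨a, a', e1, e3, dflt e⟩
  · split_ifs at e with hh
    · exact absurd ⟨hh.1, hh.2, e⟩ hc2
    · exact ⟨a, a', e1, e3, dflt e⟩
  · exact ⟨a, a', e1, e3, by linarith⟩
  · exact ⟨a, b', e1, e4, by linarith⟩
  · exact ⟨b, a', e2, e3, by linarith⟩
  · exact ⟨b, b', e2, e4, by linarith⟩

lemma mgDist_le_same {p q : MGPoint G} (h1 : p.1.1 = q.1.1) (h2 : p.1.2.1 = q.1.2.1) :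
    mgDist G p q ≤ |p.1.2.2 - q.1.2.2| := by
  unfold mgDist mgDistAux
  refine (min_le_left _ _).trans ((min_le_left _ _).trans ?_)
  rw [if_pos ⟨h1, h2⟩]

lemma mgDist_le_swap {p q : MGPoint G} (h1 : p.1.1 = q.1.2.1) (h2 : p.1.2.1 = q.1.1) :
    mgDist G p q ≤ |p.1.2.2 - (1 - q.1.2.2)| := by
  unfold mgDist mgDistAux
  refine (min_le_left _ _).trans ((min_le_right _ _).trans ?_)
  rw [if_pos ⟨h1, h2⟩]

lemma mgDist_nonneg (hG : G.Connected) (p q : MGPoint G) : 0 ≤ mgDist G p q := by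
  rcases mgDist_cases hG p q with ⟨a, b, _, _, e⟩ | ⟨_, _, e⟩ | ⟨_, _, e⟩ <;> rw [e]
  · have := vd_nonneg a p
    have := vd_nonneg b q
    positivity
  · positivity
  · positivity

/-- 1-Lipschitz -/
lemma vd_lip (hG : G.Connected) (v : V) (p q : MGPoint G) :
    mgVDist G v p ≤ mgVDist G v q + mgDist G p q := by
  rcases mgDist_cases hG p q with ⟨a, b, ha, hb, e⟩ | ⟨h1, h2, e⟩ | ⟨h1, h2, e⟩ <;> rw [e]
  · -- via b: dist v b ≤ vd v q + vd b q
    have hvb : (G.dist v b : ℝ) ≤ mgVDist G v q + mgVDist G b q := by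
      obtain ⟨⟨a', b', t'⟩, h', ht'⟩ := q
      simp only [Set.mem_Icc] at ht'
      have d1 : (G.dist a' b' : ℝ) = 1 := by exact_mod_cast dist_eq_one_iff_adj.2 h'
      have d2 : (G.dist b' a' : ℝ) = 1 := by rw [SimpleGraph.dist_comm]; exact d1
      have t1 := dist_triR hG v a' b'
      have t2 := dist_triR hG v b' a'
      unfold mgVDist
      simp only
      obtain hb | hb : b = a' ∨ b = b' := hb <;> rw [hb] <;>
      rcases min_choice ((G.dist v a' : ℝ) + t') ((G.dist v b' : ℝ) + (1 - t')) with e | e <;> rw [e]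
      · have : 0 ≤ min ((G.dist a' a' : ℝ) + t') ((G.dist a' b' : ℝ) + (1 - t')) := by
          rw [d1]; simp; constructor <;> linarith
        linarith
      · have : t' ≤ min ((G.dist a' a' : ℝ) + t') ((G.dist a' b' : ℝ) + (1 - t')) := by
          rw [d1]; simp; linarith
        linarith
      · have : 1 - t' ≤ min ((G.dist b' a' : ℝ) + t') ((G.dist b' b' : ℝ) + (1 - t')) := by
          rw [d2]; simp; linarith
        linarith
      · have : 0 ≤ min ((G.dist b' a' : ℝ) + t') ((G.dist b' b' : ℝ) + (1 - t')) := by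
          rw [d2]; simp; constructor <;> linarith
        linarith
    have := vd_tri hG v b p
    have := vd_tri hG b a p
    have : (G.dist b a : ℝ) = G.dist a b := by rw [SimpleGraph.dist_comm]
    linarith
  · unfold mgVDist
    rw [h1, h2]
    have a1 := le_abs_self (p.1.2.2 - q.1.2.2)
    have a2 := neg_abs_le (p.1.2.2 - q.1.2.2)
    rw [← min_add_add_right]
    exact min_le_min (by linarith) (by linarith)
  · unfold mgVDist
    rw [h1, h2, min_comm]
    have a1 := le_abs_self (p.1.2.2 - (1 - q.1.2.2))
    have a2 := neg_abs_le (p.1.2.2 - (1 - q.1.2.2))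
    rw [← min_add_add_right]
    exact min_le_min (by linarith) (by linarith)

lemma mgDist_comm (hG : G.Connected) (p q : MGPoint G) : mgDist G p q = mgDist G q p := by
  have key : ∀ p q : MGPoint G, mgDist G p q ≤ mgDist G q p := by
    intro p q
    rcases mgDist_cases hG q p with ⟨a, b, ha, hb, e⟩ | ⟨h1, h2, e⟩ | ⟨h1, h2, e⟩ <;> rw [e]
    · have := mgDist_le_vd hG a p q
      have := vd_tri hG a b p
      linarith
    · rw [abs_sub_comm]
      exact mgDist_le_same h1.symm h2.symm
    · refine (mgDist_le_swap h2.symm h1.symm).trans (le_of_eq ?_)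
      congr 1; ring
  exact le_antisymm (key _ _) (key _ _)

lemma mgDist_tri (hG : G.Connected) (p q r : MGPoint G) :
    mgDist G p r ≤ mgDist G p q + mgDist G q r := by
  have key : ∀ p q r : MGPoint G, ∀ a b, mgDist G p q = mgVDist G a p + G.dist a b + mgVDist G b q →
      mgDist G p r ≤ mgDist G p q + mgDist G q r := by
    intro p q r a b e
    have := mgDist_le_vd hG a p r
    have := vd_tri hG a b r
    have := vd_lip hG b r q
    have := mgDist_comm hG r q
    linarith
  rcases mgDist_cases hG p q with ⟨a, b, ha, hb, e⟩ | h
  · exact key p q r a b e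
  rcases mgDist_cases hG r q with ⟨a, b, ha, hb, e⟩ | h'
  · have := key r q p a b e
    rw [mgDist_comm hG p r, mgDist_comm hG q r, mgDist_comm hG p q]
    linarith
  rw [mgDist_comm hG q r]
  have tri : ∀ x y : ℝ, |x - y| ≤ |x| + |y| := fun x y => abs_sub x y
  rcases h with ⟨h1, h2, e⟩ | ⟨h1, h2, e⟩ <;> rcases h' with ⟨h1', h2', e'⟩ | ⟨h1', h2', e'⟩ <;> rw [e, e']
  · refine (mgDist_le_same (h1.trans h1'.symm) (h2.trans h2'.symm)).trans ?_
    refine le_trans (le_of_eq ?_) (tri _ _); congr 1; ring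
  · refine (mgDist_le_swap (h1.trans h2'.symm) (h2.trans h1'.symm)).trans ?_
    rw [← abs_neg (r.1.2.2 - _)]
    refine le_trans (le_of_eq ?_) (tri _ _); congr 1; ring
  · refine (mgDist_le_swap (h1.trans h2'.symm) (h2.trans h1'.symm)).trans ?_
    rw [← abs_neg (r.1.2.2 - _)]
    refine le_trans (le_of_eq ?_) (tri _ _); congr 1; ring
  · refine (mgDist_le_same (h1.trans h1'.symm) (h2.trans h2'.symm)).trans ?_
    refine le_trans (le_of_eq ?_) (tri _ _); congr 1; ring

lemma mgDist_vertex (hG : G.Connected) {v : V} {p q : MGPoint G} (hq : mgVDist G v q = 0) :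
    mgDist G p q = mgVDist G v p := by
  have := mgDist_le_vd hG v p q
  have := vd_lip hG v p q
  linarith

lemma vd_vertex (hG : G.Connected) {v u : V} {q : MGPoint G} (hq : mgVDist G v q = 0) :
    mgVDist G u q = G.dist u v := by
  have h1 := vd_tri hG u v q
  have h2 : (G.dist u v : ℝ) ≤ mgVDist G u q + mgVDist G v q := by
    obtain ⟨⟨a, b, t⟩, h, ht⟩ := q
    have x1 := dist_triR hG u a v
    have x2 := dist_triR hG u b v
    have c1 : (G.dist v a : ℝ) = G.dist a v := by rw [SimpleGraph.dist_comm]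
    have c2 : (G.dist v b : ℝ) = G.dist b v := by rw [SimpleGraph.dist_comm]
    simp only [Set.mem_Icc] at ht
    have d1 : (G.dist a b : ℝ) = 1 := by exact_mod_cast dist_eq_one_iff_adj.2 h
    have t1 := dist_triR hG a b v
    have t2 := dist_triR hG b a v
    have d2 : (G.dist b a : ℝ) = 1 := by rw [SimpleGraph.dist_comm]; exact d1
    unfold mgVDist
    simp only
    rcases min_choice ((G.dist v a : ℝ) + t) ((G.dist v b : ℝ) + (1 - t)) with e | e <;>
    rcases min_choice ((G.dist u a : ℝ) + t) ((G.dist u b : ℝ) + (1 - t)) with e' | e' <;>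
    rw [e, e'] <;> linarith
  linarith
end Metric

open SimpleGraph Set
set_option linter.unusedSectionVars false
set_option linter.unusedVariables false
section Cross
variable {V : Type} [Fintype V] [DecidableEq V] {G : SimpleGraph V}

/-- an edge colouring which is constant around every vertex outside `S` -/
def ValidCol (G : SimpleGraph V) {α : Type} (S : Set V) (κ : V → V → α) : Prop :=
  (∀ u v, G.Adj u v → κ u v = κ v u) ∧
    ∀ x, x ∉ S → ∀ y z, G.Adj x y → G.Adj x z → κ x y = κ x z

/-- colour of a point: colour of the edge which contains it -/
def pcol {α : Type} (κ : V → V → α) (p : MGPoint G) : α := κ p.1.1 p.1.2.1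

lemma col_walk {α : Type} {S : Set V} {κ : V → V → α} (hv : ValidCol G S κ) {a b : V}
    (w : G.Walk a b) (hw : ∀ v ∈ w.support, v ∉ S) {x y : V} (hx : G.Adj a x) (hy : G.Adj b y) :
    κ a x = κ b y := by
  induction w generalizing x with
  | nil => exact hv.2 _ (hw _ (by simp)) _ _ hx hy
  | @cons a c b h p ih =>
    rw [hv.2 a (hw _ (by simp)) x c hx h, hv.1 _ _ h]
    exact ih (fun v hv => hw v (by simp [hv])) h.symm hy

lemma pcol_end {α : Type} {S : Set V} {κ : V → V → α} (hv : ValidCol G S κ) {a : V} {p : MGPoint G}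
    (h : isEnd a p) : ∃ x, G.Adj a x ∧ pcol κ p = κ a x := by
  rcases h with rfl | rfl
  · exact ⟨_, p.2.1, rfl⟩
  · exact ⟨_, p.2.1.symm, hv.1 _ _ p.2.1⟩

lemma col_sep (hG : G.Connected) {α : Type} {S : Set V} {κ : V → V → α} (hv : ValidCol G S κ)
    (p q : MGPoint G) (hne : pcol κ p ≠ pcol κ q) :
    ∃ v ∈ S, mgVDist G v p + mgVDist G v q ≤ mgDist G p q := by
  rcases mgDist_cases hG p q with ⟨a, b, ha, hb, e⟩ | ⟨h1, h2, e⟩ | ⟨h1, h2, e⟩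
  · obtain ⟨w, hw⟩ := hG.exists_walk_length_eq_dist a b
    obtain ⟨x, hx, ex⟩ := pcol_end hv ha
    obtain ⟨y, hy, ey⟩ := pcol_end hv hb
    by_cases hS : ∀ v ∈ w.support, v ∉ S
    · exact absurd (by rw [ex, ey]; exact col_walk hv w hS hx hy) hne
    push Not at hS
    obtain ⟨v, hvw, hvS⟩ := hS
    refine ⟨v, hvS, ?_⟩
    have h1 : (G.dist v a : ℝ) + G.dist v b ≤ G.dist a b := by
      have e1 := SimpleGraph.dist_le (w.takeUntil v hvw)
      have e2 := SimpleGraph.dist_le (w.dropUntil v hvw)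
      have e3 := congrArg Walk.length (w.take_spec hvw)
      rw [Walk.length_append] at e3
      rw [SimpleGraph.dist_comm (u := v) (v := a)]
      exact_mod_cast (by omega : G.dist a v + G.dist v b ≤ G.dist a b)
    have := vd_tri hG v a p
    have := vd_tri hG v b q
    linarith
  · exact absurd (by simp [pcol, h1, h2]) hne
  · refine absurd ?_ hne
    rw [pcol, pcol, h1, h2]
    exact hv.1 _ _ q.2.1.symm

lemma geo_sub {a b a' b' : ℝ} {γ : ℝ → MGPoint G} (h : IsMGGeodesic G a b γ) (h1 : a ≤ a')
    (h2 : b' ≤ b) (h3 : a' ≤ b') : IsMGGeodesic G a' b' γ :=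
  ⟨h3, fun s hs t ht => h.2 s ⟨h1.trans hs.1, hs.2.trans h2⟩ t ⟨h1.trans ht.1, ht.2.trans h2⟩⟩

lemma cross (hG : G.Connected) {α : Type} {S : Set V} {κ : V → V → α} (hv : ValidCol G S κ)
    {a b : ℝ} {γ : ℝ → MGPoint G} (hγ : IsMGGeodesic G a b γ)
    (hav : ∀ t ∈ Icc a b, ∀ v ∈ S, mgVDist G v (γ t) ≠ 0) : pcol κ (γ a) = pcol κ (γ b) := by
  classical
  by_contra hne
  obtain ⟨hab, hd⟩ := hγ
  set A : Set ℝ := {t | t ∈ Icc a b ∧ pcol κ (γ t) = pcol κ (γ a)} with hA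
  have haA : a ∈ A := ⟨⟨le_rfl, hab⟩, rfl⟩
  have hbd : BddAbove A := ⟨b, fun t ht => ht.1.2⟩
  set τ := sSup A with hτ
  have hτa : a ≤ τ := le_csSup hbd haA
  have hτb : τ ≤ b := csSup_le ⟨a, haA⟩ fun t ht => ht.1.2
  have hτI : τ ∈ Icc a b := ⟨hτa, hτb⟩
  have key : ∀ ε > 0, ∃ v ∈ S, mgVDist G v (γ τ) < ε := by
    intro ε hε
    obtain ⟨t1, ht1, hlt⟩ := exists_lt_of_lt_csSup ⟨a, haA⟩ (show τ - ε / 4 < sSup A by linarith)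
    have ht1τ : t1 ≤ τ := le_csSup hbd ht1
    obtain ⟨t2, ht2, ht2A, hle, hlt2⟩ : ∃ t2, t2 ∈ Icc a b ∧ t2 ∉ A ∧ τ ≤ t2 ∧ t2 < τ + ε / 4 := by
      have hbA : b ∉ A := fun h => hne h.2.symm
      by_cases hτA : τ ∈ A
      · have : τ < b := lt_of_le_of_ne hτb (fun h => hbA (h ▸ hτA))
        refine ⟨min b (τ + ε / 8), ⟨le_min hab (by linarith), min_le_left _ _⟩, ?_,
          le_min hτb (by linarith), (min_le_right _ _).trans_lt (by linarith)⟩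
        intro h
        have h1 := le_csSup hbd h
        have : τ < min b (τ + ε / 8) := lt_min this (by linarith)
        linarith
      · exact ⟨τ, hτI, hτA, le_rfl, by linarith⟩
    have hcol : pcol κ (γ t1) ≠ pcol κ (γ t2) := by
      intro h
      exact ht2A ⟨ht2, by rw [← h]; exact ht1.2⟩
    obtain ⟨v, hvS, hvd⟩ := col_sep hG hv _ _ hcol
    refine ⟨v, hvS, ?_⟩
    rw [hd t1 ht1.1 t2 ht2] at hvd
    have h1 := vd_lip hG v (γ τ) (γ t1)
    rw [hd τ hτI t1 ht1.1] at h1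
    have h2 := vd_nonneg v (γ t2)
    have h3 : |t1 - t2| ≤ ε / 2 := by rw [abs_le]; constructor <;> linarith
    have h4 : |τ - t1| ≤ ε / 4 := by rw [abs_le]; constructor <;> linarith
    linarith
  obtain ⟨v0, hv0, _⟩ := key 1 one_pos
  obtain ⟨m, hm, hmin⟩ := Set.exists_min_image S (fun v => mgVDist G v (γ τ)) (Set.toFinite S) ⟨v0, hv0⟩
  have hpos : 0 < mgVDist G m (γ τ) := lt_of_le_of_ne (vd_nonneg _ _) (hav τ hτI m hm).symm
  obtain ⟨v, hvS, hlt⟩ := key _ hpos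
  exact absurd (hmin v hvS) (not_le.2 hlt)

/-- `O` contains a curve joining `x` and `y` -/
def Linked (O : Set (MGPoint G)) (x y : MGPoint G) : Prop :=
  ∀ (α : Type) (S : Set V) (κ : V → V → α), ValidCol G S κ →
    (∀ o ∈ O, ∀ v ∈ S, mgVDist G v o ≠ 0) → pcol κ x = pcol κ y

lemma Linked.trans {O : Set (MGPoint G)} {x y z : MGPoint G} (h : Linked O x y) (h' : Linked O y z) :
    Linked O x z := fun α S κ hv ho => (h α S κ hv ho).trans (h' α S κ hv ho)

lemma Linked.symm {O : Set (MGPoint G)} {x y : MGPoint G} (h : Linked O x y) :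
    Linked O y x := fun α S κ hv ho => (h α S κ hv ho).symm

lemma Linked.mono {O O' : Set (MGPoint G)} {x y : MGPoint G} (h : Linked O x y) (hs : O ⊆ O') :
    Linked O' x y := fun α S κ hv ho => h α S κ hv (fun o hoo => ho o (hs hoo))

lemma Linked.geo (hG : G.Connected) {a b : ℝ} {γ : ℝ → MGPoint G} (hγ : IsMGGeodesic G a b γ) :
    Linked (γ '' Icc a b) (γ a) (γ b) := fun α S κ hv ho =>
  cross hG hv hγ fun t ht v hvS => ho _ ⟨t, ht, rfl⟩ v hvS

lemma Linked.glue (hG : G.Connected) {O : Set (MGPoint G)} {x y : MGPoint G} (hx : x ∈ O)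
    (h : mgDist G x y = 0) : Linked O x y := by
  intro α S κ hv ho
  by_contra hne
  obtain ⟨v, hvS, hle⟩ := col_sep hG hv _ _ hne
  have h1 := vd_nonneg v x
  have h2 := vd_nonneg v y
  exact ho x hx v hvS (by linarith)

lemma thin_of (hG : G.Connected) (D : ℝ) (hD : 0 ≤ D)
    (H : ∀ (a b : ℝ) (γ : ℝ → MGPoint G), IsMGGeodesic G a b γ → ∀ O : Set (MGPoint G),
      (∃ x' ∈ O, mgDist G (γ a) x' = 0) → (∃ y' ∈ O, mgDist G (γ b) y' = 0) →
      Linked O (γ a) (γ b) → ∀ s ∈ Icc a b, ∃ o ∈ O, mgDist G (γ s) o ≤ D) :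
    hypDelta G ≤ D := by
  have main : ∀ (a1 b1 a2 b2 a3 b3 : ℝ) (g1 g2 g3 : ℝ → MGPoint G), IsMGGeodesic G a1 b1 g1 →
      IsMGGeodesic G a2 b2 g2 → IsMGGeodesic G a3 b3 g3 → mgDist G (g1 b1) (g2 a2) = 0 →
      mgDist G (g2 b2) (g3 a3) = 0 → mgDist G (g3 b3) (g1 a1) = 0 →
      ∀ s ∈ Icc a1 b1, (∃ t ∈ Icc a2 b2, mgDist G (g1 s) (g2 t) ≤ D) ∨
        (∃ t ∈ Icc a3 b3, mgDist G (g1 s) (g3 t) ≤ D) := by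
    intro a1 b1 a2 b2 a3 b3 g1 g2 g3 h1 h2 h3 e1 e2 e3 s hs
    set O : Set (MGPoint G) := (g2 '' Icc a2 b2) ∪ (g3 '' Icc a3 b3) with hO
    have m2a : g2 a2 ∈ O := Or.inl ⟨a2, ⟨le_rfl, h2.1⟩, rfl⟩
    have m2b : g2 b2 ∈ O := Or.inl ⟨b2, ⟨h2.1, le_rfl⟩, rfl⟩
    have m3b : g3 b3 ∈ O := Or.inr ⟨b3, ⟨h3.1, le_rfl⟩, rfl⟩
    have L1 : Linked O (g2 a2) (g1 b1) := Linked.glue hG m2a (by rw [mgDist_comm hG]; exact e1)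
    have L2 : Linked O (g2 a2) (g2 b2) := (Linked.geo hG h2).mono subset_union_left
    have L3 : Linked O (g2 b2) (g3 a3) := Linked.glue hG m2b e2
    have L4 : Linked O (g3 a3) (g3 b3) := (Linked.geo hG h3).mono subset_union_right
    have L5 : Linked O (g3 b3) (g1 a1) := Linked.glue hG m3b e3
    obtain ⟨o, ho, hle⟩ := H a1 b1 g1 h1 O ⟨_, m3b, by rw [mgDist_comm hG]; exact e3⟩ ⟨_, m2a, e1⟩
      ((((L1.symm.trans L2).trans L3).trans L4).trans L5).symm s hs
    rcases ho with ⟨t, ht, rfl⟩ | ⟨t, ht, rfl⟩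
    · exact Or.inl ⟨t, ht, hle⟩
    · exact Or.inr ⟨t, ht, hle⟩
  refine Real.sSup_le ?_ hD
  rintro d ⟨T, rfl⟩
  refine csInf_le ⟨0, fun d hd => hd.1⟩ ⟨hD, ?_, ?_, ?_⟩
  · exact main _ _ _ _ _ _ _ _ _ T.h1 T.h2 T.h3 T.glue1 T.glue2 T.glue3
  · intro s hs
    exact (main _ _ _ _ _ _ _ _ _ T.h2 T.h3 T.h1 T.glue2 T.glue3 T.glue1 s hs).symm
  · exact main _ _ _ _ _ _ _ _ _ T.h3 T.h1 T.h2 T.glue3 T.glue1 T.glue2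

/-- a geodesic of length at least one hits a vertex -/
lemma geo_vertex (hG : G.Connected) {a b : ℝ} {γ : ℝ → MGPoint G} (hγ : IsMGGeodesic G a b γ)
    (h1 : a + 1 ≤ b) : ∃ τ ∈ Icc a (a + 1), ∃ v, mgVDist G v (γ τ) = 0 := by
  by_contra hcon
  push Not at hcon
  have hv : ValidCol G (Set.univ : Set V) (fun u v => s(u, v)) :=
    ⟨fun u v _ => Sym2.eq_swap, fun x hx => absurd (Set.mem_univ x) hx⟩
  have hg := geo_sub hγ le_rfl h1 (by linarith : a ≤ a + 1)
  have hc := cross hG hv hg fun t ht v _ => hcon t ht v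
  have hd : mgDist G (γ a) (γ (a+1)) = 1 := by
    rw [hg.2 a ⟨le_rfl, by linarith⟩ (a+1) ⟨by linarith, le_rfl⟩]; simp
  have ha := hcon a ⟨le_rfl, by linarith⟩
  have hva : ∀ p : MGPoint G, (∀ v, mgVDist G v p ≠ 0) → 0 < p.1.2.2 ∧ p.1.2.2 < 1 := by
    intro p hp
    have h1 := hp p.1.1
    have h2 := hp p.1.2.1
    have n1 := vd_nonneg p.1.1 p
    have n2 := vd_nonneg p.1.2.1 p
    have h3 : mgVDist G p.1.1 p ≤ p.1.2.2 := by
      unfold mgVDist; refine (min_le_left _ _).trans ?_; simp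
    have h4 : mgVDist G p.1.2.1 p ≤ 1 - p.1.2.2 := by
      unfold mgVDist; refine (min_le_right _ _).trans ?_; simp
    constructor
    · exact lt_of_lt_of_le (lt_of_le_of_ne n1 h1.symm) h3
    · have := lt_of_lt_of_le (lt_of_le_of_ne n2 h2.symm) h4
      linarith
  have q1 := hva _ ha
  have q2 := hva _ (hcon (a+1) ⟨by linarith, le_rfl⟩)
  simp only [pcol, Sym2.eq_iff] at hc
  rcases hc with ⟨c1, c2⟩ | ⟨c1, c2⟩
  · have := mgDist_le_same c1 c2
    rw [hd] at this
    have h5 : |(γ a).1.2.2 - (γ (a+1)).1.2.2| < 1 := by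
      rw [abs_lt]; constructor <;> linarith [q1.1, q1.2, q2.1, q2.2]
    linarith
  · have := mgDist_le_swap c1 c2
    rw [hd] at this
    have h5 : |(γ a).1.2.2 - (1 - (γ (a+1)).1.2.2)| < 1 := by
      rw [abs_lt]; constructor <;> linarith [q1.1, q1.2, q2.1, q2.2]
    linarith

/-- a point at integer distance from a vertex is a vertex -/
lemma vertex_of_int (hG : G.Connected) (v : V) (k : ℕ) (p : MGPoint G) (h : mgVDist G v p = k) :
    ∃ u, mgVDist G u p = 0 := by
  have n1 := vd_nonneg p.1.1 p
  have n2 := vd_nonneg p.1.2.1 p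
  have h3 : mgVDist G p.1.1 p ≤ p.1.2.2 := by
    unfold mgVDist; refine (min_le_left _ _).trans ?_; simp
  have h4 : mgVDist G p.1.2.1 p ≤ 1 - p.1.2.2 := by
    unfold mgVDist; refine (min_le_right _ _).trans ?_; simp
  have hp := p.2.2
  simp only [Set.mem_Icc] at hp
  have key : ∀ (m k : ℕ) (t : ℝ), 0 ≤ t → t ≤ 1 → (m : ℝ) + t = k → t = 0 ∨ t = 1 := by
    intro m k t h0 h1 h
    have hm : m ≤ k := by
      have : (m : ℝ) ≤ k := by linarith
      exact_mod_cast this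
    obtain ⟨j, rfl⟩ := Nat.exists_eq_add_of_le hm
    push_cast at h
    have hj : (j : ℝ) ≤ 1 := by linarith
    have hj' : j ≤ 1 := by exact_mod_cast hj
    interval_cases j
    · left; push_cast at h; linarith
    · right; push_cast at h; linarith
  have : p.1.2.2 = 0 ∨ p.1.2.2 = 1 := by
    unfold mgVDist at h
    rcases min_choice ((G.dist v p.1.1 : ℝ) + p.1.2.2) ((G.dist v p.1.2.1 : ℝ) + (1 - p.1.2.2)) with e | e <;>
      rw [e] at h
    · exact key _ _ _ hp.1 hp.2 h
    · rcases key _ _ _ (by linarith) (by linarith) h with h | h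
      · right; linarith
      · left; linarith
  rcases this with e | e
  · exact ⟨p.1.1, by linarith⟩
  · exact ⟨p.1.2.1, by linarith⟩
end Cross

open SimpleGraph Set
set_option linter.unusedSectionVars false
set_option linter.unusedVariables false
section OptOne
variable {V : Type} [Fintype V] [DecidableEq V] {G : SimpleGraph V}

lemma walk_of (u : ℕ → V) (k : ℕ) (h : ∀ j < k, G.Adj (u j) (u (j + 1))) :
    ∃ p : G.Walk (u 0) (u k), p.length = k ∧ p.support = (List.range (k + 1)).map u := by
  induction k with
  | zero => exact ⟨Walk.nil, rfl, by simp⟩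
  | succ k ih =>
    obtain ⟨p, hp, hs⟩ := ih fun j hj => h j (by omega)
    refine ⟨p.concat (h k (by omega)), by simp [hp], ?_⟩
    rw [Walk.support_concat, hs, List.range_succ (n := k + 1)]
    simp

lemma end_adj (hG : G.Connected) {v : V} {x : MGPoint G} {θ : ℝ} (h : mgVDist G v x = θ)
    (h0 : 0 < θ) (h1 : θ ≤ 1) : ∃ A, isEnd A x ∧ G.Adj A v ∧ mgVDist G A x ≤ 1 - θ := by
  have h3 : mgVDist G x.1.1 x ≤ x.1.2.2 := by
    unfold mgVDist; refine (min_le_left _ _).trans ?_; simp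
  have h4 : mgVDist G x.1.2.1 x ≤ 1 - x.1.2.2 := by
    unfold mgVDist; refine (min_le_right _ _).trans ?_; simp
  have hp := x.2.2
  simp only [Set.mem_Icc] at hp
  have key : ∀ (p q : V) (t : ℝ), G.Adj p q → 0 ≤ t → t ≤ 1 → (G.dist v p : ℝ) + t = θ →
      (v = p ∧ t = θ) ∨ (G.Adj p v ∧ t = 0 ∧ θ = 1) := by
    intro p q t ha ht0 ht1 e
    have hd : (G.dist v p : ℝ) ≤ 1 := by linarith
    have hd' : G.dist v p ≤ 1 := by exact_mod_cast hd
    obtain e0 | e0 : G.dist v p = 0 ∨ G.dist v p = 1 := by omega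
    · left
      rw [e0] at e
      exact ⟨(hG.dist_eq_zero_iff).1 e0, by simpa using e⟩
    · right
      rw [e0] at e
      push_cast at e
      exact ⟨(SimpleGraph.dist_eq_one_iff_adj.1 e0).symm, by linarith, by linarith⟩
  unfold mgVDist at h
  rcases min_choice ((G.dist v x.1.1 : ℝ) + x.1.2.2) ((G.dist v x.1.2.1 : ℝ) + (1 - x.1.2.2)) with e | e <;>
      rw [e] at h
  · rcases key _ _ _ x.2.1 hp.1 hp.2 h with ⟨e1, e2⟩ | ⟨e1, e2, e3⟩
    · exact ⟨x.1.2.1, Or.inr rfl, by rw [e1]; exact x.2.1.symm, by linarith⟩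
    · exact ⟨x.1.1, Or.inl rfl, e1, by linarith⟩
  · rcases key _ _ _ x.2.1.symm (by linarith) (by linarith) h with ⟨e1, e2⟩ | ⟨e1, e2, e3⟩
    · exact ⟨x.1.1, Or.inl rfl, by rw [e1]; exact x.2.1, by linarith⟩
    · exact ⟨x.1.2.1, Or.inr rfl, e1, by linarith⟩

lemma cycle_len_le {a : V} (w : G.Walk a a) (hw : w.IsCycle) : w.length ≤ Fintype.card V := by
  have h := hw.support_nodup
  have := h.length_le_card
  simpa using this

lemma le_circ {a : V} (w : G.Walk a a) (hw : w.IsCycle) : w.length ≤ circumference G :=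
  le_csSup ⟨Fintype.card V, by rintro n ⟨a, w, hw, rfl⟩; exact cycle_len_le w hw⟩ ⟨a, w, hw, rfl⟩

lemma K_valid (S : Set V) (A : V) : ValidCol G S
    (fun u v => (∃ w : G.Walk A u, ∀ z ∈ w.support, z ∉ S) ∨ (∃ w : G.Walk A v, ∀ z ∈ w.support, z ∉ S)) := by
  refine ⟨fun u v _ => propext or_comm, ?_⟩
  have key : ∀ x, x ∉ S → ∀ y, G.Adj x y → (((∃ w : G.Walk A x, ∀ z ∈ w.support, z ∉ S) ∨
      (∃ w : G.Walk A y, ∀ z ∈ w.support, z ∉ S)) ↔ ∃ w : G.Walk A x, ∀ z ∈ w.support, z ∉ S) := by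
    intro x hx y hxy
    constructor
    · rintro (h | ⟨w, hw⟩)
      · exact h
      · refine ⟨w.concat hxy.symm, ?_⟩
        intro z hz
        rw [Walk.support_concat] at hz
        simp only [List.concat_eq_append, List.mem_append, List.mem_singleton] at hz
        rcases hz with hz | rfl
        · exact hw z hz
        · exact hx
    · exact Or.inl
  intro x hx y z hy hz
  exact propext ((key x hx y hy).trans (key x hx z hz).symm)

theorem opt_one (hG : G.Connected) (D : ℝ) (hD : 2 ≤ D) (hc : (circumference G : ℝ) < 4 * D) :
    hypDelta G ≤ D := by
  refine thin_of hG D (by linarith) ?_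
  intro a b γ hγ O hx hy hL s hs
  by_contra hcon
  push Not at hcon
  have haI : a ∈ Icc a b := ⟨le_rfl, hγ.1⟩
  have hbI : b ∈ Icc a b := ⟨hγ.1, le_rfl⟩
  have hlo : a < s - D := by
    obtain ⟨x', hx', e⟩ := hx
    have h1 := hcon x' hx'
    have h2 := mgDist_tri hG (γ s) (γ a) x'
    rw [hγ.2 s hs a haI, abs_of_nonneg (by linarith [hs.1])] at h2
    linarith
  have hhi : s + D < b := by
    obtain ⟨x', hx', e⟩ := hy
    have h1 := hcon x' hx'
    have h2 := mgDist_tri hG (γ s) (γ b) x'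
    rw [hγ.2 s hs b hbI, abs_of_nonpos (by linarith [hs.2])] at h2
    linarith
  set lo := s - D with hlodef
  set hi := s + D with hhidef
  -- vertices on the geodesic
  have vdg : ∀ {v : V} {t t' : ℝ}, t ∈ Icc a b → t' ∈ Icc a b → mgVDist G v (γ t) = 0 →
      mgVDist G v (γ t') = |t' - t| := by
    intro v t t' ht ht' hv
    rw [← mgDist_vertex hG hv]; exact hγ.2 t' ht' t ht
  have step : ∀ {v : V} {t : ℝ}, t ∈ Icc a b → mgVDist G v (γ t) = 0 → ∀ j : ℕ, t + j ∈ Icc a b →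
      ∃ u, mgVDist G u (γ (t + j)) = 0 := by
    intro v t ht hv j hj
    refine vertex_of_int hG v j _ ?_
    rw [vdg ht hj hv]; simp
  obtain ⟨τ, hτ0, hτ1, v0, hv0⟩ : ∃ τ, lo < τ ∧ τ ≤ lo + 1 ∧ ∃ v, mgVDist G v (γ τ) = 0 := by
    obtain ⟨τ, hτ, v, hv⟩ := geo_vertex hG (geo_sub hγ hlo.le hhi.le (by linarith)) (by linarith : lo + 1 ≤ hi)
    rcases eq_or_lt_of_le hτ.1 with e | e
    · obtain ⟨u, hu⟩ := step (t := τ) ⟨by linarith, by linarith [hτ.2]⟩ hv 1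
        ⟨by push_cast; linarith, by push_cast; linarith [hτ.2]⟩
      push_cast at hu
      exact ⟨τ + 1, by linarith, by linarith, u, hu⟩
    · exact ⟨τ, e, hτ.2, v, hv⟩
  obtain ⟨N, hN1, hN2⟩ : ∃ N : ℕ, τ + N < hi ∧ hi ≤ τ + N + 1 := by
    have hpos : 0 < ⌈hi - τ⌉₊ := Nat.ceil_pos.2 (by linarith)
    refine ⟨⌈hi - τ⌉₊ - 1, ?_, ?_⟩
    · have := Nat.lt_ceil.1 (Nat.sub_lt hpos one_pos)
      linarith
    · have := Nat.le_ceil (hi - τ)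
      have h2 : ((⌈hi - τ⌉₊ - 1 : ℕ) : ℝ) = (⌈hi - τ⌉₊ : ℝ) - 1 := by
        rw [Nat.cast_sub hpos]; simp
      linarith
  have hτI : τ ∈ Icc a b := ⟨by linarith, by linarith⟩
  have hjI : ∀ j : ℕ, j ≤ N → τ + j ∈ Icc a b ∧ τ + j < hi ∧ lo < τ + j := by
    intro j hj
    have : (j : ℝ) ≤ N := by exact_mod_cast hj
    have h0 : (0 : ℝ) ≤ j := Nat.cast_nonneg j
    exact ⟨⟨by linarith, by linarith⟩, by linarith, by linarith⟩
  have hex : ∀ j : ℕ, ∃ u, j ≤ N → mgVDist G u (γ (τ + j)) = 0 := by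
    intro j
    by_cases hj : j ≤ N
    · obtain ⟨u, hu⟩ := step hτI hv0 j (hjI j hj).1
      exact ⟨u, fun _ => hu⟩
    · exact ⟨v0, fun h => absurd h hj⟩
  choose u hu using hex
  have hdist : ∀ {v v' : V} {t t' : ℝ}, t ∈ Icc a b → t' ∈ Icc a b → mgVDist G v (γ t) = 0 →
      mgVDist G v' (γ t') = 0 → (G.dist v v' : ℝ) = |t - t'| := by
    intro v v' t t' ht ht' hv hv'
    rw [← vd_vertex hG hv', vdg ht ht' hv, abs_sub_comm]
  have hadj : ∀ j < N, G.Adj (u j) (u (j + 1)) := by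
    intro j hj
    have h := hdist (hjI j hj.le).1 (hjI (j+1) hj).1 (hu j hj.le) (hu (j+1) hj)
    push_cast at h
    rw [show τ + (j : ℝ) - (τ + (j + 1)) = -1 by ring] at h
    norm_num at h
    exact h
  have hinj : ∀ i ≤ N, ∀ j ≤ N, u i = u j → i = j := by
    intro i hi' j hj' e
    have h := hdist (hjI i hi').1 (hjI j hj').1 (hu i hi') (hu j hj')
    rw [e, SimpleGraph.dist_self] at h
    have h2 := abs_eq_zero.1 (by simpa using h.symm : |τ + (i : ℝ) - (τ + j)| = 0)
    have : (i : ℝ) = j := by linarith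
    exact_mod_cast this
  obtain ⟨P, hPl, hPs⟩ := walk_of u N hadj
  have hPp : P.IsPath := by
    rw [Walk.isPath_def, hPs]
    refine List.Nodup.map_on ?_ List.nodup_range
    intro i hi' j hj' e
    exact hinj i (by simpa [Nat.lt_succ_iff] using hi') j (by simpa [Nat.lt_succ_iff] using hj') e
  set S : Set V := {v | ∃ t ∈ Ioo lo hi, mgVDist G v (γ t) = 0} with hS
  have huS : ∀ j ≤ N, u j ∈ S := fun j hj => ⟨τ + j, ⟨(hjI j hj).2.2, (hjI j hj).2.1⟩, hu j hj⟩
  have hloI : lo ∈ Icc a b := ⟨hlo.le, by linarith⟩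
  have hhiI : hi ∈ Icc a b := ⟨by linarith, hhi.le⟩
  -- the extra end vertices
  obtain ⟨A, hAe, hAa, hAd⟩ := end_adj hG (v := u 0) (x := γ lo) (θ := τ - lo) (by
    rw [vdg (hjI 0 (by omega)).1 hloI (hu 0 (by omega)), abs_of_nonpos] <;> push_cast <;> linarith) (by linarith) (by linarith)
  obtain ⟨B, hBe, hBa, hBd⟩ := end_adj hG (v := u N) (x := γ hi) (θ := hi - (τ + N)) (by
    rw [vdg (hjI N le_rfl).1 hhiI (hu N le_rfl), abs_of_nonneg]; linarith) (by linarith) (by linarith)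
  have hAS : A ∉ S := by
    rintro ⟨t, ht, hA⟩
    have htI : t ∈ Icc a b := ⟨by linarith [ht.1], by linarith [ht.2]⟩
    have e1 := vdg htI hloI hA
    have e2 := hdist htI (hjI 0 (by omega)).1 hA (hu 0 (by omega))
    rw [SimpleGraph.dist_eq_one_iff_adj.2 hAa] at e2
    push_cast at e2
    rw [abs_of_nonpos (by linarith [ht.1])] at e1
    rcases abs_cases (t - (τ + 0)) with h | h <;> linarith [ht.1]
  have hBS : B ∉ S := by
    rintro ⟨t, ht, hB⟩
    have htI : t ∈ Icc a b := ⟨by linarith [ht.1], by linarith [ht.2]⟩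
    have e1 := vdg htI hhiI hB
    have e2 := hdist htI (hjI N le_rfl).1 hB (hu N le_rfl)
    rw [SimpleGraph.dist_eq_one_iff_adj.2 hBa] at e2
    push_cast at e2
    rw [abs_of_nonneg (by linarith [ht.2])] at e1
    rcases abs_cases (t - (τ + N)) with h | h <;> linarith [ht.2]
  -- colours
  have hv := K_valid (G := G) S A
  have c1 := hL _ S _ hv (by
    rintro o ho v ⟨t, ht, hvt⟩ h0
    have htI : t ∈ Icc a b := ⟨by linarith [ht.1], by linarith [ht.2]⟩
    have h1 := mgDist_le_vd hG v (γ s) o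
    rw [vdg htI hs hvt, h0] at h1
    have h2 := hcon o ho
    have h3 : |s - t| < D := by rw [abs_lt]; constructor <;> linarith [ht.1, ht.2]
    linarith)
  have avoid : ∀ t' ∈ Icc a b, t' ∉ Ioo lo hi → ∀ v ∈ S, mgVDist G v (γ t') ≠ 0 := by
    rintro t' ht' hn v ⟨t, ht, hvt⟩ h0
    have htI : t ∈ Icc a b := ⟨by linarith [ht.1], by linarith [ht.2]⟩
    rw [vdg htI ht' hvt] at h0
    have : t' = t := by linarith [abs_eq_zero.1 h0]
    exact hn (this ▸ ht)
  have c2 := cross hG hv (geo_sub hγ le_rfl hloI.2 hlo.le) (fun t ht => avoid t ⟨ht.1, by linarith [ht.2]⟩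
    (fun h => by linarith [ht.2, h.1]))
  have c3 := cross hG hv (geo_sub hγ hhiI.1 le_rfl hhi.le) (fun t ht => avoid t ⟨by linarith [ht.1], ht.2⟩
    (fun h => by linarith [ht.1, h.2]))
  have c4 := (c2.symm.trans c1).trans c3.symm
  obtain ⟨xA, hxA, eA⟩ := pcol_end hv hAe
  obtain ⟨xB, hxB, eB⟩ := pcol_end hv hBe
  rw [eA, eB] at c4
  have hKB : ∃ w : G.Walk A B, ∀ z ∈ w.support, z ∉ S := by
    have h1 := c4.mp (Or.inl ⟨Walk.nil, by simpa using hAS⟩)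
    rcases h1 with h | ⟨w, hw⟩
    · exact h
    · refine ⟨w.concat hxB.symm, ?_⟩
      intro z hz
      rw [Walk.support_concat] at hz
      simp only [List.concat_eq_append, List.mem_append, List.mem_singleton] at hz
      rcases hz with hz | rfl
      · exact hw z hz
      · exact hBS
  obtain ⟨w, hw⟩ := hKB
  set Q := w.bypass.reverse with hQ
  have hQp : Q.IsPath := (w.bypass_isPath).reverse
  have hQs : ∀ z ∈ Q.support, z ∉ S := by
    intro z hz
    rw [hQ, Walk.support_reverse, List.mem_reverse] at hz
    exact hw z (w.support_bypass_subset_support hz)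
  have hNpos : 1 ≤ N := by
    by_contra h
    have : N = 0 := by omega
    rw [this] at hN2
    push_cast at hN2
    linarith
  have hne : u N ≠ u 0 := fun h => by have := hinj N le_rfl 0 (by omega) h; omega
  have hq1 : (Q.concat hAa).IsPath := by
    rw [Walk.concat_isPath_iff]
    exact ⟨hQp, fun h => hQs _ h (huS 0 (by omega))⟩
  have hq2 : (Walk.cons hBa.symm (Q.concat hAa)).IsPath := by
    rw [Walk.cons_isPath_iff]
    refine ⟨hq1, ?_⟩
    rw [Walk.support_concat]
    simp only [List.concat_eq_append, List.mem_append, List.mem_singleton, not_or]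
    exact ⟨fun h => hQs _ h (huS N le_rfl), hne⟩
  have hcyc := Walk.IsPath.isCycle_append hPp hq2 (by
    intro z hz hz'
    rw [Walk.support_cons, List.tail_cons, Walk.support_concat] at hz'
    simp only [List.concat_eq_append, List.mem_append, List.mem_singleton] at hz'
    have hzS : z ∈ P.support := List.mem_of_mem_tail hz
    rcases hz' with h | rfl
    · rw [hPs] at hzS
      simp only [List.mem_map, List.mem_range] at hzS
      obtain ⟨j, hj, rfl⟩ := hzS
      exact hQs _ h (huS j (by omega))
    · have hnd := hPp.support_nodup
      rw [Walk.support_eq_cons, List.nodup_cons] at hnd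
      exact hnd.1 hz) (Or.inr (by simp))
  have hlen := le_circ _ hcyc
  rw [Walk.length_append, hPl, Walk.length_cons, Walk.length_concat] at hlen
  have hQl : (G.dist A B : ℝ) ≤ Q.length := by
    rw [SimpleGraph.dist_comm]; exact_mod_cast SimpleGraph.dist_le Q
  have hAB : hi - lo ≤ mgVDist G A (γ lo) + G.dist A B + mgVDist G B (γ hi) := by
    have h1 := mgDist_le_vd hG A (γ lo) (γ hi)
    have h2 := vd_tri hG A B (γ hi)
    rw [hγ.2 lo hloI hi hhiI, abs_of_nonpos (by linarith)] at h1
    linarith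
  have : (N : ℝ) + (Q.length + 1 + 1) ≤ circumference G := by exact_mod_cast hlen
  linarith
end OptOne

open SimpleGraph Set
set_option linter.unusedSectionVars false
set_option linter.unusedVariables false
section Lower
variable {V : Type} [Fintype V] [DecidableEq V] {G : SimpleGraph V}

lemma girth_cycle_param (hG : G.Connected) (g : ℕ) (hg : 5 ≤ g) (hgir : G.girth = g) :
    g ≤ Fintype.card V ∧ ∃ v : ℕ → V, (∀ k, G.Adj (v k) (v (k + 1))) ∧ (∀ k, v (k + g) = v k) ∧
      (∀ k l, G.dist (v k) (v (k + l)) ≤ l) ∧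
      (∀ k l, l ≤ g → l ≤ G.dist (v k) (v (k + l)) ∨ g - l ≤ G.dist (v k) (v (k + l))) := by
  have hac : ¬ G.IsAcyclic := by
    intro h
    rw [← girth_eq_zero] at h
    omega
  obtain ⟨a, w, hw, hl⟩ := exists_girth_eq_length.2 hac
  rw [hgir] at hl
  have hadj : ∀ k, G.Adj (w.getVert (k % g)) (w.getVert ((k+1) % g)) := by
    intro k
    have hk := Nat.mod_lt k (show 0 < g by omega)
    have h := w.adj_getVert_succ (i := k % g) (by omega)
    rcases Nat.lt_or_ge (k % g + 1) g with h1 | h1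
    · rw [show (k + 1) % g = k % g + 1 by rw [Nat.add_mod, Nat.mod_eq_of_lt (show 1 < g by omega), Nat.mod_eq_of_lt h1]]
      exact h
    · have h2 : k % g + 1 = g := by omega
      rw [h2] at h
      have : (k + 1) % g = 0 := by
        rw [Nat.add_mod, Nat.mod_eq_of_lt (show 1 < g by omega), h2, Nat.mod_self]
      rw [this]
      have h3 : w.getVert g = a := by rw [hl, Walk.getVert_length]
      rw [h3] at h
      simpa using h
  have hinj : ∀ i j, w.getVert (i % g) = w.getVert (j % g) → i % g = j % g := by
    intro i j h
    have hi := Nat.mod_lt i (show 0 < g by omega)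
    have hj := Nat.mod_lt j (show 0 < g by omega)
    have hi' : i % g ≤ w.length - 1 := by omega
    have hj' : j % g ≤ w.length - 1 := by omega
    exact hw.getVert_injOn' hi' hj' h
  have key : ∀ k l, 2 * l ≤ g → l ≤ G.dist (w.getVert (k % g)) (w.getVert ((k + l) % g)) := by
    intro k l h2
    by_contra hlt
    push Not at hlt
    obtain ⟨P, hPl, hPs⟩ := walk_of (G := G) (fun j => w.getVert ((k + j) % g)) l (fun j _ => hadj (k + j))
    have hPp : P.IsPath := by
      rw [Walk.isPath_def, hPs]
      refine List.Nodup.map_on ?_ List.nodup_range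
      intro i hi j hj e
      have := hinj _ _ e
      simp only [List.mem_range] at hi hj
      have h3 : i ≡ j [MOD g] := Nat.ModEq.add_left_cancel' k this
      have := Nat.ModEq.eq_of_lt_of_lt h3 (by omega) (by omega)
      exact this
    obtain ⟨Q, hQp, hQl⟩ := hG.exists_path_of_dist (w.getVert ((k + 0) % g)) (w.getVert ((k + l) % g))
    have hne : P ≠ Q := by
      intro h
      rw [h] at hPl
      simp only [Nat.add_zero] at hQl
      omega
    obtain ⟨z, _, _, c, hc, hcl⟩ := hPp.exists_isCycle_length_le_add_of_ne hQp hne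
    have := hc.girth_le_length
    simp only [Nat.add_zero] at hQl
    omega
  refine ⟨hl ▸ cycle_len_le w hw, fun k => w.getVert (k % g), hadj, fun k => by simp, ?_, ?_⟩
  · intro k l
    obtain ⟨P, hPl, hPs⟩ := walk_of (G := G) (fun j => w.getVert ((k + j) % g)) l (fun j _ => hadj (k + j))
    have := SimpleGraph.dist_le P
    simp only [Nat.add_zero] at this
    show G.dist (w.getVert (k % g)) (w.getVert ((k + l) % g)) ≤ l
    omega
  · intro k l hlg
    rcases Nat.lt_or_ge g (2 * l) with h | h
    · right
      have := key (k + l) (g - l) (by omega)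
      rw [show k + l + (g - l) = k + g by omega, Nat.add_mod_right, SimpleGraph.dist_comm] at this
      exact this
    · exact Or.inl (key k l h)

theorem lower_bound (hG : G.Connected) (g : ℕ) (hg : 5 ≤ g) (hgir : G.girth = g) :
    (g : ℝ) / 4 ≤ hypDelta G := by
  obtain ⟨hcard, v, hadj, hper, hup, hlow⟩ := girth_cycle_param hG g hg hgir
  have hcardR : (g : ℝ) ≤ Fintype.card V := by exact_mod_cast hcard
  have hgR : (5 : ℝ) ≤ g := by exact_mod_cast hg
  set Γ : ℝ → MGPoint G := fun t => ⟨(v ⌊t⌋₊, v (⌊t⌋₊ + 1), Int.fract t),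
    hadj _, Int.fract_nonneg t, (Int.fract_lt_one t).le⟩ with hΓ
  have hfr : ∀ t : ℝ, 0 ≤ t → Int.fract t = t - ⌊t⌋₊ := by
    intro t ht
    rw [Int.fract, natCast_floor_eq_intCast_floor ht]
  have lip' : ∀ s t : ℝ, 0 ≤ s → s ≤ t → mgDist G (Γ s) (Γ t) ≤ t - s := by
    intro s t hs hst
    have hfl : ⌊s⌋₊ ≤ ⌊t⌋₊ := Nat.floor_mono hst
    have e1 := hfr s hs
    have e2 := hfr t (hs.trans hst)
    rcases Nat.eq_or_lt_of_le hfl with h | h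
    · have := mgDist_le_same (p := Γ s) (q := Γ t) (by simp [hΓ, h]) (by simp [hΓ, h])
      refine this.trans ?_
      simp only [hΓ]
      rw [e1, e2, h, abs_of_nonpos] <;> linarith
    · have h1 := mgDist_le_vd hG (v (⌊s⌋₊ + 1)) (Γ s) (Γ t)
      have h2 : mgVDist G (v (⌊s⌋₊ + 1)) (Γ s) ≤ 1 - Int.fract s := by
        unfold mgVDist; refine (min_le_right _ _).trans ?_; simp [hΓ]
      have h3 : mgVDist G (v (⌊s⌋₊ + 1)) (Γ t) ≤ G.dist (v (⌊s⌋₊ + 1)) (v ⌊t⌋₊) + Int.fract t := by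
        unfold mgVDist; refine (min_le_left _ _).trans ?_; simp [hΓ]
      have h4 := hup (⌊s⌋₊ + 1) (⌊t⌋₊ - (⌊s⌋₊ + 1))
      rw [show ⌊s⌋₊ + 1 + (⌊t⌋₊ - (⌊s⌋₊ + 1)) = ⌊t⌋₊ by omega] at h4
      have h5 : (G.dist (v (⌊s⌋₊ + 1)) (v ⌊t⌋₊) : ℝ) ≤ (⌊t⌋₊ : ℝ) - (⌊s⌋₊ + 1) := by
        have : G.dist (v (⌊s⌋₊ + 1)) (v ⌊t⌋₊) + (⌊s⌋₊ + 1) ≤ ⌊t⌋₊ := by omega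
        have : (G.dist (v (⌊s⌋₊ + 1)) (v ⌊t⌋₊) : ℝ) + (⌊s⌋₊ + 1) ≤ ⌊t⌋₊ := by exact_mod_cast this
        linarith
      linarith
  have lip : ∀ s t : ℝ, 0 ≤ s → 0 ≤ t → mgDist G (Γ s) (Γ t) ≤ |s - t| := by
    intro s t hs ht
    rcases le_total s t with h | h
    · rw [abs_of_nonpos (by linarith)]; linarith [lip' s t hs h]
    · rw [abs_of_nonneg (by linarith), mgDist_comm hG]; linarith [lip' t s ht h]
  have anti : ∀ s : ℝ, 0 ≤ s → (g : ℝ) / 2 ≤ mgDist G (Γ s) (Γ (s + g / 2)) := by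
    intro s hs
    have hs' : 0 ≤ s + g / 2 := by positivity
    have hle : ⌊s⌋₊ ≤ ⌊s + (g : ℝ) / 2⌋₊ := Nat.floor_mono (by linarith)
    obtain ⟨l, hl⟩ := Nat.exists_eq_add_of_le hle
    set i := ⌊s⌋₊ with hi
    have e1 := hfr s hs
    have e2 := hfr _ hs'
    have x0 := Int.fract_nonneg s
    have x1 := Int.fract_lt_one s
    have y0 := Int.fract_nonneg (s + (g : ℝ) / 2)
    have y1 := Int.fract_lt_one (s + (g : ℝ) / 2)
    rw [hl] at e2
    push_cast at e2
    simp only [← hi] at e1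
    simp only [mgDist, mgDistAux, hΓ, hl, ← hi]
    set x := Int.fract s
    set y := Int.fract (s + (g : ℝ) / 2)
    have hlR : (l : ℝ) + y - x = g / 2 := by linarith
    have hl1 : 2 ≤ l := by
      have : (1 : ℝ) < l := by linarith
      exact_mod_cast this
    have hl2 : l + 2 ≤ g := by
      have : (l : ℝ) + 1 < g := by linarith
      have : l + 1 < g := by exact_mod_cast this
      omega
    have conv : ∀ k l : ℕ, l ≤ g → (l : ℝ) ≤ G.dist (v k) (v (k + l)) ∨
        (g : ℝ) - l ≤ G.dist (v k) (v (k + l)) := by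
      intro k l hlg
      rcases hlow k l hlg with h | h
      · left; exact_mod_cast h
      · right
        have : g ≤ G.dist (v k) (v (k + l)) + l := by omega
        have : (g : ℝ) ≤ G.dist (v k) (v (k + l)) + l := by exact_mod_cast this
        linarith
    have d1 := conv i l (by omega)
    have d2 := conv i (l + 1) (by omega)
    have d3 := conv (i + 1) (l - 1) (by omega)
    have d4 := conv (i + 1) l (by omega)
    rw [show i + 1 + (l - 1) = i + l by omega] at d3
    rw [show i + 1 + l = i + l + 1 by omega] at d4
    rw [← Nat.add_assoc] at d2
    rw [Nat.cast_sub (by omega)] at d3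
    push_cast at d2 d3
    have hne1 : v i ≠ v (i + l) := by
      intro h
      rw [← h, SimpleGraph.dist_self] at d1
      have : (l : ℝ) + 2 ≤ g := by exact_mod_cast hl2
      have : (2 : ℝ) ≤ l := by exact_mod_cast hl1
      push_cast at d1
      rcases d1 with d | d <;> linarith
    have hne2 : v (i + 1) ≠ v (i + l) := by
      intro h
      rw [← h, SimpleGraph.dist_self] at d3
      have : (l : ℝ) + 2 ≤ g := by exact_mod_cast hl2
      have : (2 : ℝ) ≤ l := by exact_mod_cast hl1
      push_cast at d3
      rcases d3 with d | d <;> linarith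
    rw [if_neg (fun h => hne1 h.1), if_neg (fun h => hne2 h.2)]
    refine le_min (le_min (by linarith) (by linarith)) (le_min (le_min ?_ ?_) (le_min ?_ ?_))
    · rcases d1 with d | d <;> linarith
    · rcases d2 with d | d <;> linarith
    · rcases d3 with d | d <;> linarith
    · rcases d4 with d | d <;> linarith
  have hΓg : Γ g = Γ 0 := by
    apply Subtype.ext
    have h0 := hper 0
    have h1 := hper 1
    simp only [hΓ, Nat.floor_natCast, Nat.floor_zero, Int.fract_natCast, Int.fract_zero]
    rw [Nat.zero_add] at h0
    rw [Nat.add_comm g 1, h1, h0]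
  have geo : ∀ s : ℝ, 0 ≤ s → IsMGGeodesic G s (s + g / 2) Γ := by
    intro s hs
    refine ⟨by linarith, ?_⟩
    have main : ∀ t ∈ Icc s (s + (g : ℝ) / 2), ∀ t' ∈ Icc s (s + (g : ℝ) / 2), t ≤ t' →
        mgDist G (Γ t) (Γ t') = t' - t := by
      intro t ht t' ht' h
      have h1 := anti s hs
      have h2 := lip' s t hs ht.1
      have h3 := lip' t t' (hs.trans ht.1) h
      have h4 := lip' t' (s + g / 2) (hs.trans ht'.1) ht'.2
      have h5 := mgDist_tri hG (Γ s) (Γ t) (Γ (s + g / 2))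
      have h6 := mgDist_tri hG (Γ t) (Γ t') (Γ (s + g / 2))
      linarith
    intro t ht t' ht'
    rcases le_total t t' with h | h
    · rw [main t ht t' ht' h, abs_of_nonpos (by linarith)]; ring
    · rw [mgDist_comm hG, main t' ht' t ht h, abs_of_nonneg (by linarith)]
  have zero : ∀ p : MGPoint G, mgDist G p p = 0 := by
    intro p
    have h1 := mgDist_le_same (p := p) (q := p) rfl rfl
    have h2 := mgDist_nonneg hG p p
    simp at h1
    linarith
  have hgg : (g : ℝ) / 2 + g / 2 = g := by ring
  let T : MGTriangle G :=
    { a1 := 0, b1 := 0 + g / 2, a2 := g / 2, b2 := g / 2 + g / 2, a3 := 0, b3 := 0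
      g1 := Γ, g2 := Γ, g3 := Γ
      h1 := geo 0 le_rfl
      h2 := geo (g / 2) (by positivity)
      h3 := ⟨le_rfl, by
        intro s hs t ht
        have e1 : s = 0 := le_antisymm hs.2 hs.1
        have e2 : t = 0 := le_antisymm ht.2 ht.1
        rw [e1, e2, zero]; simp⟩
      glue1 := by rw [zero_add]; exact zero _
      glue2 := by rw [hgg, hΓg]; exact zero _
      glue3 := zero _ }
  have hT : (g : ℝ) / 4 ≤ triangleDelta T := by
    refine le_csInf ⟨(Fintype.card V : ℝ) + 1, by positivity, ?_, ?_, ?_⟩ ?_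
    · intro s hs
      exact Or.inr ⟨0, ⟨le_rfl, le_rfl⟩, mgDist_le_card _ _⟩
    · intro s hs
      exact Or.inr ⟨0, ⟨le_rfl, le_rfl⟩, mgDist_le_card _ _⟩
    · intro s hs
      exact Or.inl ⟨0, ⟨le_rfl, (geo 0 le_rfl).1⟩, mgDist_le_card _ _⟩
    · rintro d ⟨hd0, hd, -, -⟩
      have far : ∀ t ∈ Icc ((g : ℝ) / 2) g, (g : ℝ) / 4 ≤ mgDist G (Γ (g / 4)) (Γ t) := by
        intro t ht
        have h1 := anti (g / 4) (by positivity)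
        have h2 := lip t (g / 4 + g / 2) (by linarith [ht.1]) (by positivity)
        have h3 : |t - ((g : ℝ) / 4 + g / 2)| ≤ g / 4 := by
          rw [abs_le]; constructor <;> linarith [ht.1, ht.2]
        have h4 := mgDist_tri hG (Γ (g / 4)) (Γ t) (Γ (g / 4 + g / 2))
        linarith
      rcases hd (g / 4) ⟨by positivity, by show (g : ℝ) / 4 ≤ 0 + g / 2; linarith⟩ with ⟨t, ht, h⟩ | ⟨t, ht, h⟩
      · have ht' : t ∈ Icc ((g : ℝ) / 2) (g / 2 + g / 2) := ht
        rw [hgg] at ht'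
        exact (far t ht').trans h
      · have e : t = 0 := le_antisymm ht.2 ht.1
        subst e
        have := far g ⟨by linarith, le_rfl⟩
        rw [hΓg] at this
        exact this.trans h
  refine hT.trans (le_csSup ⟨(Fintype.card V : ℝ) + 1, ?_⟩ ⟨T, rfl⟩)
  rintro d ⟨T', rfl⟩
  refine csInf_le ⟨0, fun d hd => hd.1⟩ ⟨by positivity, ?_, ?_, ?_⟩
  · intro s hs
    exact Or.inl ⟨T'.a2, ⟨le_rfl, T'.h2.1⟩, mgDist_le_card _ _⟩
  · intro s hs
    exact Or.inl ⟨T'.a1, ⟨le_rfl, T'.h1.1⟩, mgDist_le_card _ _⟩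
  · intro s hs
    exact Or.inl ⟨T'.a1, ⟨le_rfl, T'.h1.1⟩, mgDist_le_card _ _⟩
end Lower

open SimpleGraph Set
set_option linter.unusedSectionVars false
set_option linter.unusedVariables false
section FanAbs
variable {V : Type} [Fintype V] [DecidableEq V] {G : SimpleGraph V}

lemma end_of_lt (hG : G.Connected) {v : V} {x : MGPoint G} {θ : ℝ} (h : mgVDist G v x = θ)
    (h1 : θ < 1) : (v = x.1.1 ∧ x.1.2.2 = θ) ∨ (v = x.1.2.1 ∧ 1 - x.1.2.2 = θ) := by
  have hp := x.2.2
  simp only [Set.mem_Icc] at hp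
  have key : ∀ (p : V) (t : ℝ), 0 ≤ t → t ≤ 1 → (G.dist v p : ℝ) + t = θ → (v = p ∧ t = θ) := by
    intro p t ht0 ht1 e
    have hd : (G.dist v p : ℝ) < 1 := by linarith
    have hd' : G.dist v p < 1 := by exact_mod_cast hd
    have e0 : G.dist v p = 0 := by omega
    rw [e0] at e
    exact ⟨(hG.dist_eq_zero_iff).1 e0, by simpa using e⟩
  unfold mgVDist at h
  rcases min_choice ((G.dist v x.1.1 : ℝ) + x.1.2.2) ((G.dist v x.1.2.1 : ℝ) + (1 - x.1.2.2)) with e | e <;>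
      rw [e] at h
  · exact Or.inl (key _ _ hp.1 hp.2 h)
  · exact Or.inr (key _ _ (by linarith) (by linarith) h)

theorem fan_thin (hG : G.Connected) (o : V) (L : ℝ) (hL0 : 0 ≤ L)
    (h1 : ∀ p : MGPoint G, mgVDist G o p ≤ L / 2) {β : Type} (κ : V → V → β)
    (hκ : ValidCol G (insert o (G.neighborSet o)) κ)
    (h2 : ∀ p q : MGPoint G, pcol κ p = pcol κ q → mgDist G p q ≤ L / 2)
    (h3 : ∀ w w', G.Adj o w → G.Adj o w' → ¬ G.Adj w w')
    (h3' : ∀ w w' u, w ≠ w' → G.Adj o w → G.Adj o w' → G.Adj w u → G.Adj u w' → u = o)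
    (h4 : ∀ w, G.Adj o w → ∃ κ' : V → V → ℕ, ValidCol G ({w, o} : Set V) κ' ∧
      ∀ u u', G.Adj w u → G.Adj w u' → κ' w u = κ' w u' → u = u') :
    hypDelta G ≤ L / 4 + 1 / 2 := by
  refine thin_of hG _ (by linarith) ?_
  intro a b γ hγ O hx hy hL s hs
  have haI : a ∈ Icc a b := ⟨le_rfl, hγ.1⟩
  have hbI : b ∈ Icc a b := ⟨hγ.1, le_rfl⟩
  by_contra hcon
  push Not at hcon
  have hlo : L / 4 + 1 / 2 < s - a := by
    obtain ⟨x', hx', e⟩ := hx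
    have h1 := hcon x' hx'
    have h2 := mgDist_tri hG (γ s) (γ a) x'
    rw [hγ.2 s hs a haI, abs_of_nonneg (by linarith [hs.1])] at h2
    linarith
  have hhi : L / 4 + 1 / 2 < b - s := by
    obtain ⟨x', hx', e⟩ := hy
    have h1 := hcon x' hx'
    have h2 := mgDist_tri hG (γ s) (γ b) x'
    rw [hγ.2 s hs b hbI, abs_of_nonpos (by linarith [hs.2])] at h2
    linarith
  have vdg : ∀ {v : V} {t t' : ℝ}, t ∈ Icc a b → t' ∈ Icc a b → mgVDist G v (γ t) = 0 →
      mgVDist G v (γ t') = |t' - t| := by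
    intro v t t' ht ht' hv
    rw [← mgDist_vertex hG hv]; exact hγ.2 t' ht' t ht
  have hdist : ∀ {v v' : V} {t t' : ℝ}, t ∈ Icc a b → t' ∈ Icc a b → mgVDist G v (γ t) = 0 →
      mgVDist G v' (γ t') = 0 → (G.dist v v' : ℝ) = |t - t'| := by
    intro v v' t t' ht ht' hv hv'
    rw [← vd_vertex hG hv', vdg ht ht' hv, abs_sub_comm]
  have same : ∀ t ∈ Icc a b, ∀ t' ∈ Icc a b, t ≤ t' → pcol κ (γ t) = pcol κ (γ t') → t' - t ≤ L / 2 := by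
    intro t ht t' ht' hle e
    have := h2 _ _ e
    rw [hγ.2 t ht t' ht', abs_of_nonpos (by linarith)] at this
    linarith
  have fin : ∀ τ ∈ Icc a b, τ - a ≤ L / 2 → b - τ ≤ L / 2 → ∀ v v' : V, mgVDist G v (γ τ) = 0 →
      G.dist v' v ≤ 1 → ∀ q ∈ O, mgVDist G v' q = 0 → False := by
    intro τ hτ ha hb v v' hv hvv' q hq hvq
    have e1 := mgDist_le_vd hG v' (γ s) q
    have e2 := vd_tri hG v' v (γ s)
    rw [vdg hτ hs hv] at e2
    have e3 : (G.dist v' v : ℝ) ≤ 1 := by exact_mod_cast hvv'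
    have e4 := hcon q hq
    rcases abs_cases (s - τ) with h | h <;> linarith
  by_cases hA : ∃ τ ∈ Icc a b, mgVDist G o (γ τ) = 0
  · obtain ⟨τ, hτ, hτo⟩ := hA
    have ea := h1 (γ a)
    have eb := h1 (γ b)
    rw [vdg hτ haI hτo, abs_of_nonpos (by linarith [hτ.1])] at ea
    rw [vdg hτ hbI hτo, abs_of_nonneg (by linarith [hτ.2])] at eb
    by_cases hO : ∀ q ∈ O, ∀ v ∈ insert o (G.neighborSet o), mgVDist G v q ≠ 0
    · have := same a haI b hbI hγ.1 (hL _ _ κ hκ hO)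
      linarith
    · push Not at hO
      obtain ⟨q, hq, v, hv, hvq⟩ := hO
      refine fin τ hτ (by linarith) (by linarith) o v hτo ?_ q hq hvq
      rcases hv with rfl | hv
      · simp
      · exact (SimpleGraph.dist_eq_one_iff_adj.2 (SimpleGraph.Adj.symm hv)).le
  · push Not at hA
    by_cases hB : ∀ t ∈ Icc a b, ∀ v ∈ insert o (G.neighborSet o), mgVDist G v (γ t) ≠ 0
    · have := same a haI b hbI hγ.1 (cross hG hκ hγ hB)
      linarith
    · push Not at hB
      obtain ⟨τ, hτ, w, hw, hwτ⟩ := hB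
      have hwo : G.Adj o w := by
        rcases hw with rfl | hw
        · exact absurd hwτ (hA τ hτ)
        · exact hw
      have uniq' : ∀ τ ∈ Icc a b, ∀ τ' ∈ Icc a b, ∀ w w', G.Adj o w → G.Adj o w' →
          mgVDist G w (γ τ) = 0 → mgVDist G w' (γ τ') = 0 → τ < τ' → False := by
        intro τ hτ τ' hτ' w w' hw hw' e e' hlt
        have hd := hdist hτ hτ' e e'
        rw [abs_of_neg (by linarith)] at hd
        have hd2 : G.dist w w' ≤ 2 := by
          have := hG.dist_triangle (u := w) (v := o) (w := w')
          rw [SimpleGraph.dist_eq_one_iff_adj.2 hw', SimpleGraph.dist_eq_one_iff_adj.2 hw.symm] at this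
          exact this
        have hne : w ≠ w' := by
          rintro rfl
          rw [SimpleGraph.dist_self] at hd
          push_cast at hd
          linarith
        have hd0 : G.dist w w' ≠ 0 := fun h => hne (hG.dist_eq_zero_iff.1 h)
        have hd1 : G.dist w w' ≠ 1 := fun h => h3 w w' hw hw' (SimpleGraph.dist_eq_one_iff_adj.1 h)
        have hd3 : G.dist w w' = 2 := by omega
        rw [hd3] at hd
        push_cast at hd
        have hm : τ + 1 ∈ Icc a b := ⟨by linarith [hτ.1], by linarith [hτ'.2]⟩
        obtain ⟨u, hu⟩ := vertex_of_int hG w 1 (γ (τ + 1)) (by rw [vdg hτ hm e]; simp)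
        have a1 := hdist hτ hm e hu
        have a2 := hdist hm hτ' hu e'
        rw [abs_of_neg (by linarith)] at a1 a2
        have b1 : G.Adj w u := SimpleGraph.dist_eq_one_iff_adj.1 (by
          have : (G.dist w u : ℝ) = 1 := by linarith
          exact_mod_cast this)
        have b2 : G.Adj u w' := SimpleGraph.dist_eq_one_iff_adj.1 (by
          have : (G.dist u w' : ℝ) = 1 := by linarith
          exact_mod_cast this)
        have := h3' w w' u hne hw hw' b1 b2
        rw [this] at hu
        exact hA _ hm hu
      have avoid : ∀ t ∈ Icc a b, t ≠ τ → ∀ v ∈ insert o (G.neighborSet o), mgVDist G v (γ t) ≠ 0 := by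
        intro t ht hne v hv e
        rcases hv with rfl | hv
        · exact hA t ht e
        · rcases lt_or_gt_of_ne hne with h | h
          · exact uniq' t ht τ hτ v w hv hwo e hwτ h
          · exact uniq' τ hτ t ht w v hwo hv hwτ e h
      have avoid' : ∀ t ∈ Icc a b, t ≠ τ → ∀ v ∈ ({w, o} : Set V), mgVDist G v (γ t) ≠ 0 := by
        intro t ht hne v hv
        refine avoid t ht hne v ?_
        rcases hv with rfl | hv
        · exact Or.inr hwo
        · exact Or.inl hv
      have ea : τ - a ≤ L / 2 := by
        by_contra hh
        push Not at hh
        set ε := (τ - a - L / 2) / 2 with hε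
        have hI : τ - ε ∈ Icc a b := ⟨by linarith, by linarith [hτ.2]⟩
        have := same a haI (τ - ε) hI hI.1 (cross hG hκ (geo_sub hγ le_rfl hI.2 hI.1) fun t ht =>
          avoid t ⟨ht.1, ht.2.trans hI.2⟩ (by intro h; linarith [ht.2]))
        linarith
      have eb : b - τ ≤ L / 2 := by
        by_contra hh
        push Not at hh
        set ε := (b - τ - L / 2) / 2 with hε
        have hI : τ + ε ∈ Icc a b := ⟨by linarith [hτ.1], by linarith⟩
        have := same (τ + ε) hI b hbI hI.2 (cross hG hκ (geo_sub hγ hI.1 le_rfl hI.2) fun t ht =>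
          avoid t ⟨hI.1.trans ht.1, ht.2⟩ (by intro h; linarith [ht.1]))
        linarith
      have hO : ∀ q ∈ O, ∀ v ∈ ({w, o} : Set V), mgVDist G v q ≠ 0 := by
        intro q hq v hv e
        refine fin τ hτ ea eb w v hwτ ?_ q hq e
        rcases hv with rfl | hv
        · simp
        · rw [show v = o from hv]
          exact (SimpleGraph.dist_eq_one_iff_adj.2 hwo).le
      obtain ⟨κ', hκ', hinj⟩ := h4 w hwo
      have c1 := hL _ _ κ' hκ' hO
      have hτa : a < τ := by
        refine lt_of_le_of_ne hτ.1 ?_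
        rintro rfl
        obtain ⟨q, hq, e⟩ := hx
        refine hO q hq w (Or.inl rfl) ?_
        have := vd_lip hG w q (γ a)
        rw [mgDist_comm hG] at this
        have := vd_nonneg w q
        linarith
      have hτb : τ < b := by
        refine lt_of_le_of_ne hτ.2 ?_
        rintro rfl
        obtain ⟨q, hq, e⟩ := hy
        refine hO q hq w (Or.inl rfl) ?_
        have := vd_lip hG w q (γ τ)
        rw [mgDist_comm hG] at this
        have := vd_nonneg w q
        linarith
      obtain ⟨ε, hε0, hε1, hεa, hεb⟩ : ∃ ε : ℝ, 0 < ε ∧ ε < 1 ∧ a ≤ τ - ε ∧ τ + ε ≤ b := by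
        refine ⟨min (1 / 2) (min (τ - a) (b - τ)), ?_, ?_, ?_, ?_⟩
        · refine lt_min (by norm_num) (lt_min (by linarith) (by linarith))
        · exact (min_le_left _ _).trans_lt (by norm_num)
        · have := (min_le_right (1 / 2) (min (τ - a) (b - τ))).trans (min_le_left _ _)
          linarith
        · have := (min_le_right (1 / 2) (min (τ - a) (b - τ))).trans (min_le_right _ _)
          linarith
      have c2 := cross hG hκ' (geo_sub hγ le_rfl (by linarith : τ - ε ≤ b) hεa) fun t ht =>
          avoid' t ⟨ht.1, by linarith [ht.2]⟩ (by intro h; linarith [ht.2])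
      have c3 := cross hG hκ' (geo_sub hγ (by linarith : a ≤ τ + ε) le_rfl hεb) fun t ht =>
          avoid' t ⟨by linarith [ht.1], ht.2⟩ (by intro h; linarith [ht.1])
      have c4 := (c2.symm.trans c1).trans c3.symm
      have hI1 : τ - ε ∈ Icc a b := ⟨hεa, by linarith⟩
      have hI2 : τ + ε ∈ Icc a b := ⟨by linarith, hεb⟩
      have f1 : mgVDist G w (γ (τ - ε)) = ε := by
        rw [vdg hτ hI1 hwτ, abs_of_neg] <;> linarith
      have f2 : mgVDist G w (γ (τ + ε)) = ε := by
        rw [vdg hτ hI2 hwτ, abs_of_pos] <;> linarith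
      have f3 := hγ.2 _ hI1 _ hI2
      rw [abs_of_neg (by linarith)] at f3
      generalize γ (τ - ε) = p at *
      generalize γ (τ + ε) = q at *
      unfold pcol at c4
      have hsp := hκ'.1 _ _ p.2.1
      have hsq := hκ'.1 _ _ q.2.1
      rcases end_of_lt hG f1 hε1 with ⟨e1, e2⟩ | ⟨e1, e2⟩ <;>
        rcases end_of_lt hG f2 hε1 with ⟨e3, e4⟩ | ⟨e3, e4⟩
      · have hu := hinj p.1.2.1 q.1.2.1 (by rw [e1]; exact p.2.1) (by rw [e3]; exact q.2.1) (by
          rw [← e1, ← e3] at c4; exact c4)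
        have := mgDist_le_same (e1.symm.trans e3) hu
        rw [e2, e4] at this
        simp at this
        linarith
      · have hu := hinj p.1.2.1 q.1.1 (by rw [e1]; exact p.2.1) (by rw [e3]; exact q.2.1.symm) (by
          rw [hsq, ← e1, ← e3] at c4; exact c4)
        have := mgDist_le_swap (e1.symm.trans e3) hu
        rw [e2, e4] at this
        simp at this
        linarith
      · have hu := hinj p.1.1 q.1.2.1 (by rw [e1]; exact p.2.1.symm) (by rw [e3]; exact q.2.1) (by
          rw [hsp, ← e1, ← e3] at c4; exact c4)
        have := mgDist_le_swap hu (e1.symm.trans e3)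
        rw [show p.1.2.2 = 1 - q.1.2.2 by linarith] at this
        simp at this
        linarith
      · have hu := hinj p.1.1 q.1.1 (by rw [e1]; exact p.2.1.symm) (by rw [e3]; exact q.2.1.symm) (by
          rw [hsp, hsq, ← e1, ← e3] at c4; exact c4)
        have := mgDist_le_same hu (e1.symm.trans e3)
        rw [show p.1.2.2 = q.1.2.2 by linarith] at this
        simp at this
        linarith
end FanAbs

open SimpleGraph Set
set_option linter.unusedSectionVars false
set_option linter.unusedVariables false
section Fan

/-- the fan with hub `0`, rim `1, …, c-1`, chords to the rim vertices satisfying `P`,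
and pendant vertices `c, …, k` attached to the hub -/
def fan (k c : ℕ) (P : ℕ → Prop) : SimpleGraph (Fin (k + 1)) where
  Adj u v := (u.val = 0 ∧ v.val ≠ 0 ∧ (P v.val ∨ c ≤ v.val)) ∨
    (v.val = 0 ∧ u.val ≠ 0 ∧ (P u.val ∨ c ≤ u.val)) ∨
    (u.val ≠ 0 ∧ v.val ≠ 0 ∧ u.val < c ∧ v.val < c ∧ (u.val + 1 = v.val ∨ v.val + 1 = u.val))
  symm := ⟨fun u v h => by tauto⟩
  loopless := ⟨fun u h => by omega⟩

structure FanHyp (k c g L : ℕ) (P : ℕ → Prop) : Prop where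
  g5 : 5 ≤ g
  ck : c ≤ k + 1
  gc : g < c
  P1 : P 1
  Pg : P (g - 1)
  Pc : P (c - 1)
  rng : ∀ w, P w → 1 ≤ w ∧ w < c
  sep : ∀ w w', P w → P w' → w < w' → w + (g - 2) ≤ w'
  cover : ∀ j, 1 ≤ j → j + 1 < c → ∃ w w', P w ∧ P w' ∧ w ≤ j ∧ j < w' ∧ w' + 2 ≤ w + L

variable {k c g L : ℕ} {P : ℕ → Prop}

def vx (k : ℕ) (j : ℕ) : Fin (k + 1) := if h : j < k + 1 then ⟨j, h⟩ else 0

lemma vx_val {j : ℕ} (h : j < k + 1) : (vx k j).val = j := by simp [vx, h]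

lemma vx_self (u : Fin (k + 1)) : vx k u.val = u := by
  apply Fin.ext; rw [vx_val u.2]

lemma rim_adj (H : FanHyp k c g L P) {j : ℕ} (h1 : 1 ≤ j) (h2 : j + 1 < c) :
    (fan k c P).Adj (vx k j) (vx k (j + 1)) := by
  have := H.ck
  right; right
  rw [vx_val (by omega), vx_val (by omega)]
  omega

lemma rim_walk (H : FanHyp k c g L P) {i j : ℕ} (h1 : 1 ≤ i) (h2 : i ≤ j) (h3 : j < c) :
    ∃ p : (fan k c P).Walk (vx k i) (vx k j), p.length = j - i := by
  obtain ⟨p, hp, _⟩ := walk_of (G := fan k c P) (fun l => vx k (i + l)) (j - i) (fun l hl =>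
    rim_adj H (by omega) (by omega))
  have e' : vx k (i + (j - i)) = vx k j := by rw [show i + (j - i) = j by omega]
  exact ⟨p.copy rfl e', by simp [hp]⟩

lemma hub_adj (H : FanHyp k c g L P) {w : ℕ} (hw : P w) : (fan k c P).Adj 0 (vx k w) := by
  have := H.ck
  have h := H.rng w hw
  left
  rw [vx_val (by omega)]
  exact ⟨rfl, by omega, Or.inl hw⟩

lemma cover' (H : FanHyp k c g L P) {j : ℕ} (h1 : 1 ≤ j) (h2 : j < c) :
    ∃ w, P w ∧ w ≤ j := ⟨1, H.P1, h1⟩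

lemma fan_conn (H : FanHyp k c g L P) : (fan k c P).Connected := by
  have : ∀ u, (fan k c P).Reachable 0 u := by
    intro u
    rcases Nat.eq_zero_or_pos u.val with h | h
    · rw [show u = 0 from Fin.ext h]
    rcases Nat.lt_or_ge u.val c with h2 | h2
    · obtain ⟨p, _⟩ := rim_walk H le_rfl h h2
      rw [vx_self] at p
      exact (hub_adj H H.P1).reachable.trans p.reachable
    · exact (show (fan k c P).Adj 0 u from Or.inl ⟨rfl, by omega, Or.inr h2⟩).reachable
  exact ⟨fun u v => (this u).symm.trans (this v)⟩

lemma rim_dist (H : FanHyp k c g L P) {i j : ℕ} (h1 : 1 ≤ i) (h2 : i ≤ j) (h3 : j < c) :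
    ((fan k c P).dist (vx k i) (vx k j) : ℝ) ≤ j - i := by
  obtain ⟨p, hp⟩ := rim_walk H h1 h2 h3
  have := SimpleGraph.dist_le p
  have h : (fan k c P).dist (vx k i) (vx k j) + i ≤ j := by omega
  have : ((fan k c P).dist (vx k i) (vx k j) : ℝ) + i ≤ j := by exact_mod_cast h
  linarith

lemma hub_dist (H : FanHyp k c g L P) {w : ℕ} (hw : P w) :
    ((fan k c P).dist 0 (vx k w) : ℝ) = 1 := by
  exact_mod_cast SimpleGraph.dist_eq_one_iff_adj.2 (hub_adj H hw)

lemma L_ge (H : FanHyp k c g L P) : 3 ≤ L := by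
  have := H.g5
  have := H.gc
  obtain ⟨w, w', _, _, h1, h2, h3⟩ := H.cover 1 le_rfl (by omega)
  omega

/-- a rim point: data of its position -/
lemma rim_point (H : FanHyp k c g L P) (p : MGPoint (fan k c P)) (h0 : p.1.1.val ≠ 0)
    (h0' : p.1.2.1.val ≠ 0) : ∃ (j : ℕ) (x : ℝ), 1 ≤ j ∧ j + 1 < c ∧
      min p.1.1.val p.1.2.1.val = j ∧ (j : ℝ) ≤ x ∧ x ≤ j + 1 ∧
      ((p.1.1 = vx k j ∧ p.1.2.1 = vx k (j + 1) ∧ p.1.2.2 = x - j) ∨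
        (p.1.1 = vx k (j + 1) ∧ p.1.2.1 = vx k j ∧ p.1.2.2 = 1 - (x - j))) := by
  have hp := p.2.2
  simp only [Set.mem_Icc] at hp
  rcases p.2.1 with h | h | ⟨h1, h2, h3, h4, h5⟩
  · exact absurd h.1 h0
  · exact absurd h.1 h0'
  · rcases h5 with h5 | h5
    · refine ⟨p.1.1.val, p.1.1.val + p.1.2.2, by omega, by omega, by omega, by linarith, by linarith, Or.inl ⟨(vx_self _).symm, ?_, by ring⟩⟩
      rw [h5, vx_self]
    · refine ⟨p.1.2.1.val, p.1.2.1.val + (1 - p.1.2.2), by omega, by omega, by omega, by linarith, by linarith,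
        Or.inr ⟨?_, (vx_self _).symm, by ring⟩⟩
      rw [h5, vx_self]

lemma vd_fst {V : Type} [Fintype V] [DecidableEq V] {G : SimpleGraph V} (p : MGPoint G) :
    mgVDist G p.1.1 p ≤ p.1.2.2 := by
  unfold mgVDist; refine (min_le_left _ _).trans ?_; simp

lemma vd_snd {V : Type} [Fintype V] [DecidableEq V] {G : SimpleGraph V} (p : MGPoint G) :
    mgVDist G p.1.2.1 p ≤ 1 - p.1.2.2 := by
  unfold mgVDist; refine (min_le_right _ _).trans ?_; simp

lemma rim_vd (H : FanHyp k c g L P) (p : MGPoint (fan k c P)) (j : ℕ) (x : ℝ) (hj : 1 ≤ j) (hjc : j + 1 < c)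
    (hx : ((p.1.1 = vx k j ∧ p.1.2.1 = vx k (j + 1) ∧ p.1.2.2 = x - j) ∨
        (p.1.1 = vx k (j + 1) ∧ p.1.2.1 = vx k j ∧ p.1.2.2 = 1 - (x - j)))) (i : ℕ) (hi : 1 ≤ i) (hic : i < c) :
    (i ≤ j → mgVDist (fan k c P) (vx k i) p ≤ x - i) ∧ (j + 1 ≤ i → mgVDist (fan k c P) (vx k i) p ≤ i - x) := by
  have hG := fan_conn H
  have e : mgVDist (fan k c P) (vx k j) p ≤ x - j ∧ mgVDist (fan k c P) (vx k (j + 1)) p ≤ j + 1 - x := by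
    have f1 := vd_fst p
    have f2 := vd_snd p
    rcases hx with ⟨e1, e2, e3⟩ | ⟨e1, e2, e3⟩ <;> rw [e1] at f1 <;> rw [e2] at f2 <;> constructor <;> linarith
  constructor
  · intro h
    have h1 := vd_tri hG (vx k i) (vx k j) p
    have h2 := rim_dist H hi h (by omega)
    linarith [e.1]
  · intro h
    have h1 := vd_tri hG (vx k i) (vx k (j + 1)) p
    have h2 := rim_dist H (by omega) h (by omega)
    rw [SimpleGraph.dist_comm] at h2
    push_cast at h2
    linarith [e.2]

lemma fan_vd (H : FanHyp k c g L P) (p : MGPoint (fan k c P)) : mgVDist (fan k c P) 0 p ≤ (L : ℝ) / 2 := by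
  have hG := fan_conn H
  have hL : (3 : ℝ) ≤ L := by exact_mod_cast L_ge H
  have hp := p.2.2
  simp only [Set.mem_Icc] at hp
  by_cases h0 : p.1.1.val = 0
  · have := vd_fst p
    rw [show p.1.1 = 0 from Fin.ext h0] at this
    linarith
  by_cases h0' : p.1.2.1.val = 0
  · have := vd_snd p
    rw [show p.1.2.1 = 0 from Fin.ext h0'] at this
    linarith
  obtain ⟨j, x, hj, hjc, _, hx1, hx2, hx⟩ := rim_point H p h0 h0'
  obtain ⟨w, w', hw, hw', h1, h2, h3⟩ := H.cover j hj hjc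
  have e1 := (rim_vd H p j x hj hjc hx w (H.rng w hw).1 (H.rng w hw).2).1 h1
  have e2 := (rim_vd H p j x hj hjc hx w' (H.rng w' hw').1 (H.rng w' hw').2).2 h2
  have f1 := vd_tri hG 0 (vx k w) p
  have f2 := vd_tri hG 0 (vx k w') p
  rw [hub_dist H hw] at f1
  rw [hub_dist H hw'] at f2
  have : (w' : ℝ) + 2 ≤ w + L := by exact_mod_cast h3
  linarith

open Classical in
/-- colouring by pieces -/
noncomputable def fcol (k : ℕ) (P : ℕ → Prop) (u v : Fin (k + 1)) : ℕ × ℕ :=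
  if min u.val v.val = 0 then (0, max u.val v.val) else (1, Nat.findGreatest P (min u.val v.val))

open Classical in
lemma fcol_valid (H : FanHyp k c g L P) :
    ValidCol (fan k c P) (insert 0 ((fan k c P).neighborSet 0)) (fcol k P) := by
  constructor
  · intro u v _
    unfold fcol
    rw [min_comm, max_comm]
  · intro x hx
    simp only [Set.mem_insert_iff, not_or, SimpleGraph.mem_neighborSet] at hx
    obtain ⟨hx0, hxN⟩ := hx
    have hx0' : x.val ≠ 0 := fun h => hx0 (Fin.ext h)
    have hP : ¬ P x.val := fun h => hxN (Or.inl ⟨rfl, hx0', Or.inl h⟩)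
    have hxc : x.val < c := by
      by_contra h
      exact hxN (Or.inl ⟨rfl, hx0', Or.inr (by omega)⟩)
    have key : ∀ y, (fan k c P).Adj x y → fcol k P x y = (1, Nat.findGreatest P x.val) := by
      intro y hy
      rcases hy with h | h | ⟨h1, h2, h3, h4, h5⟩
      · exact absurd h.1 hx0'
      · rcases h.2.2 with h | h
        · exact absurd h hP
        · omega
      · unfold fcol
        rw [if_neg (by omega)]
        rcases h5 with h5 | h5
        · rw [show min x.val y.val = x.val by omega]
        · rw [show min x.val y.val = y.val by omega, ← h5, Nat.findGreatest_succ, if_neg (by rwa [h5])]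
    intro y z hy hz
    rw [key y hy, key z hz]

lemma fcol_close (H : FanHyp k c g L P) (p q : MGPoint (fan k c P))
    (h : pcol (fcol k P) p = pcol (fcol k P) q) : mgDist (fan k c P) p q ≤ (L : ℝ) / 2 := by
  classical
  have hG := fan_conn H
  have hL : (3 : ℝ) ≤ L := by exact_mod_cast L_ge H
  have hp := p.2.2
  have hq := q.2.2
  simp only [Set.mem_Icc] at hp hq
  unfold pcol fcol at h
  have hpz : ∀ p : MGPoint (fan k c P), min p.1.1.val p.1.2.1.val = 0 ↔ p.1.1.val = 0 ∨ p.1.2.1.val = 0 := by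
    intro p; omega
  have hone : ∀ p : MGPoint (fan k c P), ¬ (p.1.1.val = 0 ∧ p.1.2.1.val = 0) := by
    intro p h
    exact p.2.1.ne (Fin.ext (by omega))
  split_ifs at h with h1 h2 h2
  · have hm := (Prod.mk.inj h).2
    have o1 := hone p
    have o2 := hone q
    by_cases hs : p.1.1.val = q.1.1.val
    · have := mgDist_le_same (p := p) (q := q) (Fin.ext hs) (Fin.ext (by omega))
      have h5 : |p.1.2.2 - q.1.2.2| ≤ 1 := by rw [abs_le]; constructor <;> linarith
      linarith
    · have := mgDist_le_swap (p := p) (q := q) (Fin.ext (by omega)) (Fin.ext (by omega))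
      have h5 : |p.1.2.2 - (1 - q.1.2.2)| ≤ 1 := by rw [abs_le]; constructor <;> linarith
      linarith
  · exact absurd (Prod.mk.inj h).1 (by norm_num)
  · exact absurd (Prod.mk.inj h).1 (by norm_num)
  · have hm := (Prod.mk.inj h).2
    rw [hpz] at h1 h2
    push Not at h1 h2
    obtain ⟨i, x, hi, hic, hmi, hx1, hx2, hx⟩ := rim_point H p h1.1 h1.2
    obtain ⟨j, y, hj, hjc, hmj, hy1, hy2, hy⟩ := rim_point H q h2.1 h2.2
    rw [hmi, hmj] at hm
    clear h h1 h2 hmi hmj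
    have main : ∀ (p q : MGPoint (fan k c P)) (i j : ℕ) (x y : ℝ), 1 ≤ i → i + 1 < c → 1 ≤ j → j + 1 < c →
        (i : ℝ) ≤ x → x ≤ i + 1 → (j : ℝ) ≤ y → y ≤ j + 1 →
        ((p.1.1 = vx k i ∧ p.1.2.1 = vx k (i + 1) ∧ p.1.2.2 = x - i) ∨
          (p.1.1 = vx k (i + 1) ∧ p.1.2.1 = vx k i ∧ p.1.2.2 = 1 - (x - i))) →
        ((q.1.1 = vx k j ∧ q.1.2.1 = vx k (j + 1) ∧ q.1.2.2 = y - j) ∨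
          (q.1.1 = vx k (j + 1) ∧ q.1.2.1 = vx k j ∧ q.1.2.2 = 1 - (y - j))) →
        Nat.findGreatest P i = Nat.findGreatest P j → i ≤ j → x ≤ y → mgDist (fan k c P) p q ≤ (L : ℝ) / 2 := by
      intro p q i j x y hi hic hj hjc hx1 hx2 hy1 hy2 hx hy hm hij hxy
      obtain ⟨w, w', hw, hw', q1, q2, q3⟩ := H.cover j hj hjc
      have hwi : w ≤ i := by
        have := Nat.le_findGreatest q1 hw
        rw [← hm] at this
        exact this.trans (Nat.findGreatest_le i)
      have e1 := (rim_vd H p i x hi hic hx w (H.rng w hw).1 (H.rng w hw).2).1 hwi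
      have e2 := (rim_vd H q j y hj hjc hy w' (H.rng w' hw').1 (H.rng w' hw').2).2 q2
      have f1 := vd_tri hG 0 (vx k w) p
      have f2 := vd_tri hG 0 (vx k w') q
      rw [hub_dist H hw] at f1
      rw [hub_dist H hw'] at f2
      have q4 : (w' : ℝ) + 2 ≤ w + L := by exact_mod_cast q3
      have f3 := mgDist_le_vd hG 0 p q
      have f4 : mgDist (fan k c P) p q ≤ y - x := by
        rcases Nat.eq_or_lt_of_le hij with rfl | hlt
        · have r1 : |x - i - (y - i)| = y - x := by rw [abs_of_nonpos] <;> linarith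
          have r2 : |1 - (x - i) - (1 - (y - i))| = y - x := by rw [abs_of_nonneg] <;> linarith
          have r3 : |x - i - (1 - (1 - (y - i)))| = y - x := by rw [abs_of_nonpos] <;> linarith
          have r4 : |1 - (x - i) - (1 - (y - i))| = y - x := by rw [abs_of_nonneg] <;> linarith
          rcases hx with ⟨a1, a2, a3⟩ | ⟨a1, a2, a3⟩ <;> rcases hy with ⟨b1, b2, b3⟩ | ⟨b1, b2, b3⟩
          · have := mgDist_le_same (p := p) (q := q) (a1.trans b1.symm) (a2.trans b2.symm)
            rwa [a3, b3, r1] at this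
          · have := mgDist_le_swap (p := p) (q := q) (a1.trans b2.symm) (a2.trans b1.symm)
            rwa [a3, b3, r3] at this
          · have := mgDist_le_swap (p := p) (q := q) (a1.trans b2.symm) (a2.trans b1.symm)
            rwa [a3, b3, r2] at this
          · have := mgDist_le_same (p := p) (q := q) (a1.trans b1.symm) (a2.trans b2.symm)
            rwa [a3, b3, r4] at this
        · have g1 := (rim_vd H p i x hi hic hx (i + 1) (by omega) hic).2 le_rfl
          have g2 := (rim_vd H q j y hj hjc hy (i + 1) (by omega) hic).1 hlt
          have g3 := mgDist_le_vd hG (vx k (i + 1)) p q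
          push_cast at g1 g2
          linarith
      linarith
    rcases Nat.lt_trichotomy i j with hl | hl | hl
    · refine main p q i j x y hi hic hj hjc hx1 hx2 hy1 hy2 hx hy hm hl.le ?_
      have : (i : ℝ) + 1 ≤ j := by exact_mod_cast hl
      linarith
    · rcases le_total x y with hxy | hxy
      · exact main p q i j x y hi hic hj hjc hx1 hx2 hy1 hy2 hx hy hm hl.le hxy
      · rw [mgDist_comm hG]
        exact main q p j i y x hj hjc hi hic hy1 hy2 hx1 hx2 hy hx hm.symm hl.ge hxy
    · rw [mgDist_comm hG]
      refine main q p j i y x hj hjc hi hic hy1 hy2 hx1 hx2 hy hx hm.symm hl.le ?_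
      have : (j : ℝ) + 1 ≤ i := by exact_mod_cast hl
      linarith

lemma fan_hyp (H : FanHyp k c g L P) : hypDelta (fan k c P) ≤ (L : ℝ) / 4 + 1 / 2 := by
  have g5 := H.g5
  refine fan_thin (fan_conn H) 0 L (Nat.cast_nonneg _) (fan_vd H) (fcol k P) (fcol_valid H) (fcol_close H) ?_ ?_ ?_
  · intro w w' hw hw' h
    have hw0 : w.val ≠ 0 := fun h => hw.ne (Fin.ext h.symm)
    have hw0' : w'.val ≠ 0 := fun h => hw'.ne (Fin.ext h.symm)
    rcases h with h | h | ⟨h1, h2, h3, h4, h5⟩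
    · exact hw0 h.1
    · exact hw0' h.1
    · have p1 : P w.val := by
        rcases hw with q | q | q
        · rcases q.2.2 with q | q
          · exact q
          · omega
        · omega
        · simp at q
      have p2 : P w'.val := by
        rcases hw' with q | q | q
        · rcases q.2.2 with q | q
          · exact q
          · omega
        · omega
        · simp at q
      rcases h5 with h5 | h5
      · have := H.sep _ _ p1 p2 (by omega); omega
      · have := H.sep _ _ p2 p1 (by omega); omega
  · intro w w' u hne hw hw' h h'
    by_contra hu
    have hu0 : u.val ≠ 0 := fun h => hu (Fin.ext h)
    have hw0 : w.val ≠ 0 := fun h => hw.ne (Fin.ext h.symm)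
    have hw0' : w'.val ≠ 0 := fun h => hw'.ne (Fin.ext h.symm)
    have hne' : w.val ≠ w'.val := fun h => hne (Fin.ext h)
    rcases h with h | h | ⟨h1, h2, h3, h4, h5⟩
    · exact hw0 h.1
    · exact hu0 h.1
    rcases h' with h' | h' | ⟨k1, k2, k3, k4, k5⟩
    · exact hu0 h'.1
    · exact hw0' h'.1
    have p1 : P w.val := by
      rcases hw with q | q | q
      · rcases q.2.2 with q | q
        · exact q
        · omega
      · omega
      · simp at q
    have p2 : P w'.val := by
      rcases hw' with q | q | q
      · rcases q.2.2 with q | q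
        · exact q
        · omega
      · omega
      · simp at q
    rcases Nat.lt_or_gt_of_ne hne' with h5 | h5
    · have := H.sep _ _ p1 p2 (by omega); omega
    · have := H.sep _ _ p2 p1 (by omega); omega
  · intro w hw
    have hw0 : w.val ≠ 0 := fun h => hw.ne (Fin.ext h.symm)
    refine ⟨fun u v => if max u.val v.val > w.val then 1 else
      if max u.val v.val = w.val ∧ min u.val v.val = 0 then 2 else 0, ⟨?_, ?_⟩, ?_⟩
    · intro u v _
      simp only [max_comm, min_comm]
    · intro x hx
      simp only [Set.mem_insert_iff, Set.mem_singleton_iff, not_or] at hx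
      have hxw : x.val ≠ w.val := fun h => hx.1 (Fin.ext h)
      have hx0 : x.val ≠ 0 := fun h => hx.2 (Fin.ext h)
      intro y z hy hz
      rcases hy with h | h | h <;> rcases hz with q | q | q <;> (try omega) <;>
        (simp only []; split_ifs <;> omega)
    · intro u u' hu hu' e
      apply Fin.ext
      rcases hu with h | h | h <;> rcases hu' with q | q | q <;> (try omega) <;>
        (simp only [] at e; split_ifs at e <;> omega)
end Fan

open SimpleGraph Set
set_option linter.unusedSectionVars false
set_option linter.unusedVariables false
section FanGirth
variable {k c g L : ℕ} {P : ℕ → Prop}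

lemma fan_cycle (H : FanHyp k c g L P) {m : ℕ} (hm : P m) (h2 : 2 ≤ m) :
    ∃ w : (fan k c P).Walk (vx k 0) (vx k 0), w.IsCycle ∧ w.length = m + 1 := by
  have hck := H.ck
  have hr := H.rng m hm
  have h00 : vx k 0 = 0 := Fin.ext (vx_val (by omega))
  obtain ⟨p, hl, hs⟩ := walk_of (G := fan k c P) (vx k) m (by
    intro j hj
    rcases Nat.eq_zero_or_pos j with rfl | h
    · rw [h00]; exact hub_adj H H.P1
    · exact rim_adj H h (by omega))
  have hp : p.IsPath := by
    rw [Walk.isPath_def, hs]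
    refine List.Nodup.map_on ?_ List.nodup_range
    intro i hi j hj e
    simp only [List.mem_range] at hi hj
    have := congrArg Fin.val e
    rwa [vx_val (by omega), vx_val (by omega)] at this
  have ha : (fan k c P).Adj (vx k m) (vx k 0) := by rw [h00]; exact (hub_adj H hm).symm
  have hq : (Walk.cons ha Walk.nil).IsPath := by simpa using ha.ne
  refine ⟨p.append (Walk.cons ha Walk.nil), Walk.IsPath.isCycle_append hp hq ?_ (Or.inl (by omega)), by simp [hl]⟩
  intro z hz hz'
  have hz0 : z = vx k 0 := by simpa using hz'
  subst hz0
  have hnd := hp.support_nodup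
  rw [← Walk.cons_tail_support, List.nodup_cons] at hnd
  exact hnd.1 hz

lemma cycle_nbrs (H : FanHyp k c g L P) {z : Fin (k + 1)} (w : (fan k c P).Walk z z) (hw : w.IsCycle) :
    ∃ x ∈ w.support, ∃ y ∈ w.support, x ≠ y ∧ (fan k c P).Adj z x ∧ (fan k c P).Adj z y :=
  ⟨w.snd, w.getVert_mem_support _, w.penultimate, w.getVert_mem_support _, hw.snd_ne_penultimate,
    w.adj_snd hw.not_nil, (w.adj_penultimate hw.not_nil).symm⟩

lemma cycle_no_pendant (H : FanHyp k c g L P) {a : Fin (k + 1)} (w : (fan k c P).Walk a a) (hw : w.IsCycle) :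
    ∀ z ∈ w.support, z.val < c := by
  intro z hz
  by_contra hc
  obtain ⟨x, _, y, _, hne, hx, hy⟩ := cycle_nbrs H (w.rotate z hz) (hw.rotate hz)
  have : 0 < c := by have := H.gc; omega
  apply hne
  apply Fin.ext
  rcases hx with h | h | h <;> rcases hy with q | q | q <;> omega

lemma cycle_hub (H : FanHyp k c g L P) {a : Fin (k + 1)} (w : (fan k c P).Walk a a) (hw : w.IsCycle) :
    0 ∈ w.support := by
  by_contra h0
  obtain ⟨M, hM, hmax⟩ := Finset.exists_max_image w.support.toFinset (fun z => z.val)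
    ⟨a, by simp⟩
  have hM' : M ∈ w.support := by simpa using hM
  have nz : ∀ z ∈ w.support, z.val ≠ 0 := fun z hz h => h0 (by rwa [show z = 0 from Fin.ext h] at hz)
  obtain ⟨x, hx1, y, hy1, hne, hx, hy⟩ := cycle_nbrs H (w.rotate M hM') (hw.rotate hM')
  rw [Walk.mem_support_rotate_iff] at hx1 hy1
  have m1 := hmax x (by simpa using hx1)
  have m2 := hmax y (by simpa using hy1)
  have n0 := nz M hM'
  have n1 := nz x hx1
  have n2 := nz y hy1
  apply hne
  apply Fin.ext
  rcases hx with h | h | h <;> rcases hy with q | q | q <;> omega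

lemma cycle_long (H : FanHyp k c g L P) {a : Fin (k + 1)} (w : (fan k c P).Walk a a) (hw : w.IsCycle) :
    g ≤ w.length := by
  have h0 := cycle_hub H w hw
  have hlt' := cycle_no_pendant H w hw
  rw [← w.length_rotate 0 h0]
  have hc := hw.rotate h0
  have hlt : ∀ z ∈ (w.rotate 0 h0).support, z.val < c := fun z hz =>
    hlt' z ((Walk.mem_support_rotate_iff ..).1 hz)
  generalize w.rotate 0 h0 = p at hc hlt
  have h3 := hc.three_le_length
  have g5 := H.g5
  have nz : ∀ i, 1 ≤ i → i < p.length → (p.getVert i).val ≠ 0 := by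
    intro i h1 h2 h
    have h4 : p.getVert i = p.getVert p.length := by rw [Walk.getVert_length]; exact Fin.ext h
    have := hc.getVert_injOn (show i ∈ {i | 1 ≤ i ∧ i ≤ p.length} from ⟨h1, h2.le⟩)
      (show p.length ∈ {i | 1 ≤ i ∧ i ≤ p.length} from ⟨by omega, le_rfl⟩) h4
    omega
  have key : ∀ i, i + 1 < p.length → (p.getVert (i + 1)).val ≤ (p.getVert 1).val + i ∧
      (p.getVert 1).val ≤ (p.getVert (i + 1)).val + i := by
    intro i
    induction i with
    | zero => intro _; simp
    | succ i ih =>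
      intro hi
      have := ih (by omega)
      have n1 := nz (i + 1) (by omega) (by omega)
      have n2 := nz (i + 1 + 1) (by omega) (by omega)
      rcases p.adj_getVert_succ (i := i + 1) (by omega) with h | h | h <;> omega
  have k1 := key (p.length - 2) (by omega)
  rw [show p.length - 2 + 1 = p.length - 1 by omega] at k1
  have hne := hc.snd_ne_penultimate
  have a1 := p.adj_snd hc.not_nil
  have a2 := (p.adj_penultimate hc.not_nil).symm
  unfold Walk.penultimate at hne a2
  unfold Walk.snd at hne a1
  have n1 := nz 1 (by omega) (by omega)
  have n2 := nz (p.length - 1) (by omega) (by omega)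
  have l1 := hlt (p.getVert 1) (p.getVert_mem_support _)
  have l2 := hlt (p.getVert (p.length - 1)) (p.getVert_mem_support _)
  generalize p.getVert 1 = x at *
  generalize p.getVert (p.length - 1) = y at *
  have hP : ∀ z : Fin (k + 1), (fan k c P).Adj 0 z → z.val ≠ 0 → z.val < c → P z.val := by
    intro z hz h0 hlt
    rcases hz with h | h | h
    · rcases h.2.2 with h | h
      · exact h
      · omega
    · exact absurd h.1 h0
    · exact absurd rfl h.1
  have p1 := hP x a1 n1 l1
  have p2 := hP y a2 n2 l2
  have hne' : x.val ≠ y.val := fun h => hne (Fin.ext h)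
  rcases Nat.lt_or_gt_of_ne hne' with h | h
  · have := H.sep _ _ p1 p2 h; omega
  · have := H.sep _ _ p2 p1 h; omega

lemma cycle_short (H : FanHyp k c g L P) {a : Fin (k + 1)} (w : (fan k c P).Walk a a) (hw : w.IsCycle) :
    w.length ≤ c := by
  have h := hw.support_nodup
  have hlt := cycle_no_pendant H w hw
  have h1 : w.support.tail.length = w.length := by simp
  rw [← h1, ← List.length_map (f := Fin.val)]
  have h2 : (w.support.tail.map Fin.val).Nodup := h.map Fin.val_injective
  have h3 : w.support.tail.map Fin.val ⊆ List.range c := by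
    intro x hx
    simp only [List.mem_map] at hx
    obtain ⟨z, hz, rfl⟩ := hx
    exact List.mem_range.2 (hlt z (List.mem_of_mem_tail hz))
  have := (h2.subperm h3).length_le
  simpa using this

lemma fan_mem (H : FanHyp k c g L P) : memGclass g c (fan k c P) := by
  have g5 := H.g5
  have gc := H.gc
  refine ⟨fan_conn H, ?_, ?_⟩
  · obtain ⟨w, hw, hl⟩ := fan_cycle H H.Pg (by omega)
    refine le_antisymm ?_ ?_
    · have := girth_le_length hw
      omega
    · obtain ⟨a, w', hw', hl'⟩ := exists_girth_eq_length.2 (fun h => h w hw : ¬ (fan k c P).IsAcyclic)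
      rw [hl']
      exact cycle_long H w' hw'
  · obtain ⟨w, hw, hl⟩ := fan_cycle H H.Pc (by omega)
    refine le_antisymm ?_ ?_
    · refine csSup_le ⟨_, _, w, hw, rfl⟩ ?_
      rintro n ⟨a, w', hw', rfl⟩
      exact cycle_short H w' hw'
    · have := le_circ w hw
      omega
end FanGirth

open SimpleGraph Set
set_option linter.unusedVariables false
set_option linter.unusedSectionVars false
section final

lemma fanHyp_one (k c g : ℕ) (hg : 5 ≤ g) (hc : 2 * g - 2 ≤ c) (hc' : c < 3 * g - 4)
    (hk : c ≤ k + 1) : FanHyp k c g (2 * g - 3) (fun w => w = 1 ∨ w = g - 1 ∨ w = c - 1) where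
  g5 := hg
  ck := hk
  gc := by omega
  P1 := by simp
  Pg := by simp
  Pc := by simp
  rng := by intro w hw; omega
  sep := by intro w w' h h' hl; omega
  cover := by
    intro j h1 h2
    by_cases h : j < g - 1
    · exact ⟨1, g - 1, by simp, by simp, by omega, by omega, by omega⟩
    · exact ⟨g - 1, c - 1, by simp, by simp, by omega, by omega, by omega⟩

lemma fanHyp_two (k c g : ℕ) (hg : 5 ≤ g) (hc : c = 3 * g - 4)
    (hk : c ≤ k + 1) :
    FanHyp k c g g (fun w => w = 1 ∨ w = g - 1 ∨ w = 2 * g - 3 ∨ w = c - 1) where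
  g5 := hg
  ck := hk
  gc := by omega
  P1 := by simp
  Pg := by simp
  Pc := by simp
  rng := by intro w hw; omega
  sep := by intro w w' h h' hl; omega
  cover := by
    intro j h1 h2
    by_cases h : j < g - 1
    · exact ⟨1, g - 1, by simp, by simp, by omega, by omega, by omega⟩
    · by_cases h' : j < 2 * g - 3
      · exact ⟨g - 1, 2 * g - 3, by simp, by simp, by omega, by omega, by omega⟩
      · exact ⟨2 * g - 3, c - 1, by simp, by simp, by omega, by omega, by omega⟩

lemma exists_split (a m : ℕ) (ha : 1 ≤ a) (hm : 3 * a ≤ m) :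
    ∃ q r, m = q * a + r ∧ 1 ≤ q ∧ 2 * a ≤ r ∧ r < 3 * a := by
  have h1 := Nat.div_add_mod m a
  have h2 := Nat.mod_lt m ha
  have h3 : 3 ≤ m / a := (Nat.le_div_iff_mul_le ha).2 hm
  obtain ⟨s, hs⟩ := Nat.exists_eq_add_of_le h3
  refine ⟨s + 1, 2 * a + m % a, ?_, by omega, by omega, by omega⟩
  rw [hs] at h1
  nlinarith

lemma fanHyp_three (k c g : ℕ) (hg : 5 ≤ g) (hc : 3 * g - 4 < c)
    (hk : c ≤ k + 1) :
    ∃ P, FanHyp k c g ((3 * g + 1) / 2) P := by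
  obtain ⟨a, rfl⟩ : ∃ a, g = a + 2 := ⟨g - 2, by omega⟩
  obtain ⟨m, rfl⟩ : ∃ m, c = m + 2 := ⟨c - 2, by omega⟩
  obtain ⟨q, r, hm, hq, hr, hr'⟩ := exists_split a m (by omega) (by omega)
  have hqa : a ≤ q * a := Nat.le_mul_of_pos_left a hq
  refine ⟨fun w => (∃ i, i ≤ q ∧ w = 1 + i * a) ∨ w = 1 + q * a + r / 2 ∨ w = m + 1,
    hg, hk, by omega, Or.inl ⟨0, by omega, by simp⟩, Or.inl ⟨1, hq, by omega⟩,
    Or.inr (Or.inr (by omega)), ?_, ?_, ?_⟩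
  · rintro w (⟨i, hi, rfl⟩ | rfl | rfl)
    · have := Nat.mul_le_mul_right a hi
      omega
    · omega
    · omega
  · rintro w w' (⟨i, hi, rfl⟩ | rfl | rfl) (⟨i', hi', rfl⟩ | rfl | rfl) hl
    · have hii : i < i' := by
        by_contra hcon
        have := Nat.mul_le_mul_right a (not_lt.1 hcon)
        omega
      have := Nat.mul_le_mul_right a (Nat.succ_le_of_lt hii)
      rw [Nat.succ_mul] at this
      omega
    · have := Nat.mul_le_mul_right a hi
      omega
    · have := Nat.mul_le_mul_right a hi
      omega
    · have := Nat.mul_le_mul_right a hi'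
      omega
    · omega
    · omega
    · have := Nat.mul_le_mul_right a hi'
      omega
    · omega
    · omega
  · intro j h1 h2
    by_cases hj : j < 1 + q * a
    · have e1 := Nat.div_add_mod (j - 1) a
      have e2 := Nat.mod_lt (j - 1) (show 0 < a by omega)
      have e3 : (j - 1) / a < q := Nat.div_lt_of_lt_mul (by rw [mul_comm]; omega)
      rw [mul_comm] at e1
      refine ⟨1 + (j - 1) / a * a, 1 + ((j - 1) / a + 1) * a, Or.inl ⟨_, by omega, rfl⟩,
        Or.inl ⟨_, by omega, rfl⟩, by omega, ?_, ?_⟩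
      · rw [Nat.succ_mul]; omega
      · rw [Nat.succ_mul]; omega
    · by_cases hj' : j < 1 + q * a + r / 2
      · exact ⟨1 + q * a, 1 + q * a + r / 2, Or.inl ⟨q, le_rfl, rfl⟩, Or.inr (Or.inl rfl),
          by omega, by omega, by omega⟩
      · exact ⟨1 + q * a + r / 2, m + 1, Or.inr (Or.inl rfl), Or.inr (Or.inr rfl),
          by omega, by omega, by omega⟩

lemma Agcn_le (g c n : ℕ) (hg : 5 ≤ g) (G : SimpleGraph (Fin n)) (hG : memGclass g c G) (D : ℝ)
    (hD : hypDelta G ≤ D) : Agcn g c n ≤ D := by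
  refine le_trans (csInf_le ⟨(g : ℝ) / 4, ?_⟩ ⟨G, hG, rfl⟩) hD
  rintro d ⟨G', h', rfl⟩
  exact lower_bound h'.1 g hg h'.2.1

end final

theorem Agcn_bounds' (g c n : ℕ) (hg : 5 ≤ g) (hgc : g ≤ c) (hcn : c ≤ n)
    (hadm : ∃ G : SimpleGraph (Fin n), memGclass g c G) :
    (g : ℝ) / 4 ≤ Agcn g c n ∧
    (c < 3 * g - 4 → Agcn g c n ≤ (2 * (g : ℝ) - 1) / 4) ∧
    (c = 3 * g - 4 →
      (Even g → Agcn g c n ≤ ((g : ℝ) + 2) / 4) ∧ (Odd g → Agcn g c n ≤ ((g : ℝ) + 3) / 4)) ∧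
    (3 * g - 4 < c →
      (Even g → Agcn g c n ≤ (3 * (g : ℝ) + 5) / 8) ∧
      (Odd g → Agcn g c n ≤ (3 * (g : ℝ) + 7) / 8)) := by
  have hg' : (5 : ℝ) ≤ g := by exact_mod_cast hg
  obtain ⟨k, rfl⟩ : ∃ k, n = k + 1 := ⟨n - 1, by omega⟩
  have key : ∀ (L : ℕ) (P : ℕ → Prop), FanHyp k c g L P →
      Agcn g c (k + 1) ≤ (L : ℝ) / 4 + 1 / 2 := fun L P H =>
    Agcn_le g c (k + 1) hg (fan k c P) (fan_mem H) _ (fan_hyp H)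
  refine ⟨?_, ?_, ?_, ?_⟩
  · obtain ⟨G, hG⟩ := hadm
    refine le_csInf ⟨_, G, hG, rfl⟩ ?_
    rintro d ⟨G', h', rfl⟩
    exact lower_bound h'.1 g hg h'.2.1
  · intro hc
    by_cases h : c < 2 * g - 2
    · obtain ⟨G, hG⟩ := hadm
      refine Agcn_le g c (k + 1) hg G hG _ (opt_one hG.1 _ (by linarith) ?_)
      rw [hG.2.2]
      have : ((c + 2 : ℕ) : ℝ) < ((2 * g : ℕ) : ℝ) := by exact_mod_cast (by omega)
      push_cast at this
      linarith
    · have := key _ _ (fanHyp_one k c g hg (by omega) hc hcn)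
      have e : ((2 * g - 3 : ℕ) : ℝ) = 2 * g - 3 := by
        rw [Nat.cast_sub (by omega)]; push_cast; ring
      rw [e] at this
      linarith
  · intro hc
    have := key _ _ (fanHyp_two k c g hg hc hcn)
    exact ⟨fun _ => by linarith, fun _ => by linarith⟩
  · intro hc
    obtain ⟨P, H⟩ := fanHyp_three k c g hg hc hcn
    have := key _ _ H
    have e : (((3 * g + 1) / 2 : ℕ) : ℝ) ≤ (3 * g + 1) / 2 := by
      have := @Nat.cast_div_le ℝ _ _ _ (3 * g + 1) 2
      push_cast at this
      simpa using this
    exact ⟨fun _ => by linarith, fun _ => by linarith⟩
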